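/- arXiv:1605.00393 — 4 statements merged into one kernel-verified Lean document; each statement's English description precedes it below -/
import Mathlib

section
/- For every x ∈ ℂ \ {0} and every n ∈ ℤ, θ_q(−i q^{−1/2} x) ψ_n^{−}(x) + θ_q(i q^{−1/2} x) ψ_n^{+}(x) = (−1;q)_∞ · x^n q^{n(n−1)/2} ∑_{k=0}^∞ q^{2k(k−1)} (−q^{−2n+4} x^{−2})^k / (q²;q²)_k. -/
open Complex Filter Topology

/-- Finite q-Pochhammer symbol `(a;q)_n`. -/
noncomputable def qp (q a : ℂ) (n : ℕ) : ℂ := ∏ k ∈ Finset.range n, (1 - a * q ^ k)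

/-- Infinite q-Pochhammer symbol `(a;q)_∞`. -/
noncomputable def qpInf (q a : ℂ) : ℂ := ∏' k : ℕ, (1 - a * q ^ k)

/-- Theta function `θ_q(x) = (x;q)_∞ (q/x;q)_∞`. -/
noncomputable def theta (q x : ℂ) : ℂ := qpInf q x * qpInf q (q / x)

/-- Real power of `q`, coerced to `ℂ`. -/
noncomputable def qr (q : ℝ) (r : ℝ) : ℂ := ((q ^ r : ℝ) : ℂ)

/-- The solutions ψ_n^{±}(x); `s = 1` gives `ψ⁺`, `s = -1` gives `ψ⁻`. -/
noncomputable def psi (q : ℝ) (s x : ℂ) (n : ℤ) : ℂ :=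
  (s * Complex.I) ^ n * qr q ((n : ℝ) / 2) *
    ∑' k : ℕ, (-1) ^ k * (q : ℂ) ^ (k * (k - 1) / 2) *
      (-s * Complex.I * x * qr q ((n : ℝ) + 1 / 2)) ^ k /
        (qp (q : ℂ) (q : ℂ) k * qp (q : ℂ) (-(q : ℂ)) k)

/-- A sequence whose consecutive ratios tend to `0` is absolutely summable. -/
lemma summable_norm_of_ratio_tendsto_zero {f g : ℕ → ℂ} (h : ∀ k, f (k + 1) = f k * g k)
    (hg : Tendsto g atTop (𝓝 0)) : Summable fun k ↦ ‖f k‖ := by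
  refine summable_of_ratio_norm_eventually_le (r := 1 / 2) (by norm_num) ?_
  have h1 : ∀ᶠ k in atTop, ‖g k‖ < 1 / 2 := by
    have := hg.norm
    rw [norm_zero] at this
    exact this.eventually_lt_const (by norm_num)
  filter_upwards [h1] with k hk
  rw [h, norm_norm, norm_norm, norm_mul, mul_comm]
  gcongr

section Pochhammer

variable {q : ℂ}

lemma summable_norm_mul_pow (hq : ‖q‖ < 1) (a : ℂ) : Summable fun k : ℕ ↦ ‖-(a * q ^ k)‖ := by
  simp only [norm_neg, norm_mul, norm_pow]
  exact (summable_geometric_of_lt_one (norm_nonneg _) hq).mul_left _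

lemma multipliable_qpInf (hq : ‖q‖ < 1) (a : ℂ) : Multipliable fun k : ℕ ↦ 1 - a * q ^ k := by
  simpa only [sub_eq_add_neg] using multipliable_one_add_of_summable (summable_norm_mul_pow hq a)

lemma tendsto_qp (hq : ‖q‖ < 1) (a : ℂ) : Tendsto (qp q a) atTop (𝓝 (qpInf q a)) :=
  (multipliable_qpInf hq a).hasProd.tendsto_prod_nat

lemma qp_zero (q a : ℂ) : qp q a 0 = 1 := by simp [qp]

lemma qp_succ (q a : ℂ) (n : ℕ) : qp q a (n + 1) = qp q a n * (1 - a * q ^ n) :=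
  Finset.prod_range_succ _ _

lemma qp_self_succ (q : ℂ) (n : ℕ) : qp q q (n + 1) = qp q q n * (1 - q ^ (n + 1)) := by
  rw [qp_succ, pow_succ']

lemma one_sub_pow_succ_ne_zero (hq : ‖q‖ < 1) (n : ℕ) : 1 - q ^ (n + 1) ≠ 0 := by
  intro h
  have h1 : ‖q ^ (n + 1)‖ < 1 := by
    rw [norm_pow]; exact pow_lt_one₀ (norm_nonneg _) hq (Nat.succ_ne_zero n)
  rw [← sub_eq_zero.mp h, norm_one] at h1
  exact lt_irrefl _ h1

lemma qp_self_ne_zero (hq : ‖q‖ < 1) (n : ℕ) : qp q q n ≠ 0 := by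
  induction n with
  | zero => simp [qp_zero]
  | succ n ih => rw [qp_self_succ]; exact mul_ne_zero ih (one_sub_pow_succ_ne_zero hq n)

lemma qpInf_self_ne_zero (hq : ‖q‖ < 1) : qpInf q q ≠ 0 := by
  have := tprod_one_add_ne_zero_of_summable (f := fun k : ℕ ↦ -(q * q ^ k))
    (fun k ↦ by
      rw [← sub_eq_add_neg, ← pow_succ']; exact one_sub_pow_succ_ne_zero hq k)
    (summable_norm_mul_pow hq q)
  simpa only [qpInf, sub_eq_add_neg] using this

lemma qpInf_eq_qp_mul (hq : ‖q‖ < 1) (a : ℂ) (n : ℕ) :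
    qpInf q a = qp q a n * qpInf q (a * q ^ n) := by
  have h1 : Tendsto (fun m ↦ qp q a (n + m)) atTop (𝓝 (qpInf q a)) :=
    (tendsto_qp hq a).comp (tendsto_add_atTop_nat n |>.congr fun m ↦ add_comm m n)
  refine tendsto_nhds_unique h1 (((tendsto_qp hq (a * q ^ n)).const_mul (qp q a n)).congr ?_)
  intro m
  simp only [qp, Finset.prod_range_add, pow_add, mul_assoc]

lemma qpInf_eq_one_sub_mul (hq : ‖q‖ < 1) (a : ℂ) :
    qpInf q a = (1 - a) * qpInf q (a * q) := by
  simpa [qp] using qpInf_eq_qp_mul hq a 1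

lemma qpInf_zpow_of_nonpos (hq : ‖q‖ < 1) (hq0 : q ≠ 0) {j : ℤ} (hj : j ≤ 0) :
    qpInf q (q ^ j) = 0 := by
  obtain ⟨m, rfl⟩ : ∃ m : ℕ, j = -m := ⟨(-j).toNat, by omega⟩
  rw [qpInf_eq_qp_mul hq _ (m + 1), qp_succ]
  simp [hq0]

lemma qpInf_pow_succ (hq : ‖q‖ < 1) (n : ℕ) :
    qpInf q (q ^ (n + 1)) = qpInf q q / qp q q n := by
  rw [eq_div_iff (qp_self_ne_zero hq n), qpInf_eq_qp_mul hq q n, ← pow_succ', mul_comm]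

lemma qpInf_neg_one_mul (hq : ‖q‖ < 1) :
    qpInf q (-1) * qpInf q q = 2 * qpInf (q ^ 2) (q ^ 2) := by
  have h : qpInf q (-1 * q) * qpInf q q = qpInf (q ^ 2) (q ^ 2) := by
    rw [qpInf, qpInf, ← (multipliable_qpInf hq _).tprod_mul (multipliable_qpInf hq _)]
    exact tprod_congr fun k ↦ by ring
  rw [qpInf_eq_one_sub_mul hq (-1), mul_assoc, h]
  norm_num

lemma qp_mul_qp_neg (q : ℂ) (k : ℕ) : qp q q k * qp q (-q) k = qp (q ^ 2) (q ^ 2) k := by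
  rw [qp, qp, qp, ← Finset.prod_mul_distrib]
  exact Finset.prod_congr rfl fun k _ ↦ by ring

lemma pow_succ_choose (q : ℂ) (k : ℕ) :
    q ^ ((k + 1) * (k + 1 - 1) / 2) = q ^ (k * (k - 1) / 2) * q ^ k := by
  rw [← pow_add]
  congr 1
  have : (k + 1) * (k + 1 - 1) = k * (k - 1) + k * 2 := by
    cases k with
    | zero => rfl
    | succ k => simp; ring
  rw [this, Nat.add_mul_div_right _ _ (by norm_num)]

/-- Terms of the Euler expansion of `(z;q)_∞`. -/
noncomputable def eulerTerm (q z : ℂ) (k : ℕ) : ℂ :=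
  (-1) ^ k * q ^ (k * (k - 1) / 2) * z ^ k / qp q q k

lemma eulerTerm_succ (hq : ‖q‖ < 1) (z : ℂ) (k : ℕ) :
    eulerTerm q z (k + 1) = eulerTerm q z k * (-(q ^ k * z) / (1 - q ^ (k + 1))) := by
  have := one_sub_pow_succ_ne_zero hq k
  have := qp_self_ne_zero hq k
  rw [eulerTerm, eulerTerm, pow_succ_choose, qp_self_succ]
  field_simp
  ring

lemma summable_norm_eulerTerm (hq : ‖q‖ < 1) (z : ℂ) : Summable fun k ↦ ‖eulerTerm q z k‖ := by
  refine summable_norm_of_ratio_tendsto_zero (eulerTerm_succ hq z) ?_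
  have h := tendsto_pow_atTop_nhds_zero_of_norm_lt_one hq
  have h1 := ((h.mul_const z).neg).div ((tendsto_const_nhds (x := (1 : ℂ))).sub
    ((tendsto_add_atTop_iff_nat 1).mpr h)) (by simp)
  simpa [Pi.div_def] using h1

lemma eulerTerm_mul_pow (q z : ℂ) (n k : ℕ) :
    eulerTerm q (z * q ^ n) k = eulerTerm q z k * (q ^ n) ^ k := by
  rw [eulerTerm, eulerTerm, mul_pow]; ring

lemma tsum_eulerTerm_eq_one_sub_mul (hq : ‖q‖ < 1) (z : ℂ) :
    ∑' k, eulerTerm q z k = (1 - z) * ∑' k, eulerTerm q (z * q) k := by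
  have hz := (summable_norm_eulerTerm hq z).of_norm
  have hzq := (summable_norm_eulerTerm hq (z * q)).of_norm
  have key : ∑' k, eulerTerm q z k - ∑' k, eulerTerm q (z * q) k
      = -z * ∑' k, eulerTerm q (z * q) k := by
    rw [← hz.tsum_sub hzq, (hz.sub hzq).tsum_eq_zero_add, ← tsum_mul_left]
    simp only [eulerTerm, pow_zero, qp_zero, sub_self, zero_add]
    refine tsum_congr fun k ↦ ?_
    have := one_sub_pow_succ_ne_zero hq k
    have := qp_self_ne_zero hq k
    rw [pow_succ_choose, qp_self_succ]
    field_simp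
    ring
  linear_combination key

lemma tsum_eulerTerm_eq_qp_mul (hq : ‖q‖ < 1) (z : ℂ) (n : ℕ) :
    ∑' k, eulerTerm q z k = qp q z n * ∑' k, eulerTerm q (z * q ^ n) k := by
  induction n with
  | zero => simp [qp_zero]
  | succ n ih =>
    rw [ih, tsum_eulerTerm_eq_one_sub_mul hq (z * q ^ n), qp_succ, mul_assoc z, ← pow_succ]
    ring

/-- The Euler identity for `(z;q)_∞`. -/
theorem tsum_eulerTerm (hq : ‖q‖ < 1) (z : ℂ) : ∑' k, eulerTerm q z k = qpInf q z := by
  have h0 : Tendsto (fun n ↦ ∑' k, eulerTerm q (z * q ^ n) k) atTop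
      (𝓝 (∑' k, if k = 0 then 1 else 0)) := by
    refine tendsto_tsum_of_dominated_convergence (summable_norm_eulerTerm hq z) ?_ ?_
    · intro k
      simp only [eulerTerm_mul_pow]
      rcases k with _ | k
      · simp [eulerTerm, qp_zero]
      · have h := ((tendsto_pow_atTop_nhds_zero_of_norm_lt_one hq).pow (k + 1)).const_mul
          (eulerTerm q z (k + 1))
        simpa using h
    · refine .of_forall fun n k ↦ ?_
      rw [eulerTerm_mul_pow, norm_mul, norm_pow, norm_pow]
      exact mul_le_of_le_one_right (norm_nonneg _)
        (pow_le_one₀ (by positivity) (pow_le_one₀ (norm_nonneg _) hq.le))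
  rw [tsum_ite_eq] at h0
  have h1 := (tendsto_qp hq z).mul h0
  rw [mul_one] at h1
  exact tendsto_nhds_unique (tendsto_const_nhds.congr (tsum_eulerTerm_eq_qp_mul hq z)) h1

end Pochhammer

section Theta

variable {q : ℂ}

/-- Terms of the bilateral theta series. -/
noncomputable def thetaTerm (q z : ℂ) (m : ℤ) : ℂ := (-1) ^ m * q ^ (m * (m - 1) / 2) * z ^ m

lemma int_choose_succ (m : ℤ) : (m + 1) * (m + 1 - 1) / 2 = m * (m - 1) / 2 + m := by
  rw [show (m + 1) * (m + 1 - 1) = m * (m - 1) + m * 2 by ring,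
    Int.add_mul_ediv_right _ _ (by norm_num)]

lemma thetaTerm_add_one (hq0 : q ≠ 0) {z : ℂ} (hz : z ≠ 0) (m : ℤ) :
    thetaTerm q z (m + 1) = thetaTerm q z m * (-(q ^ m * z)) := by
  rw [thetaTerm, thetaTerm, int_choose_succ, zpow_add₀ hq0, zpow_add_one₀ hz,
    zpow_add_one₀ (by norm_num)]
  ring

lemma thetaTerm_sub_one (hq0 : q ≠ 0) {z : ℂ} (hz : z ≠ 0) (m : ℤ) :
    thetaTerm q z (m - 1) = thetaTerm q z m * (-(q ^ (1 - m) / z)) := by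
  have h := thetaTerm_add_one hq0 hz (m - 1)
  rw [sub_add_cancel] at h
  rw [h, show 1 - m = -(m - 1) by ring, zpow_neg]
  have := zpow_ne_zero (m - 1) hq0
  field_simp

lemma thetaTerm_neg (hq0 : q ≠ 0) {z : ℂ} (m : ℤ) :
    thetaTerm q z (-m) = thetaTerm q (q / z) m := by
  have h : -m * (-m - 1) / 2 = m * (m - 1) / 2 + m := by
    rw [← int_choose_succ]; congr 1; ring
  rw [thetaTerm, thetaTerm, h, zpow_add₀ hq0, div_zpow, zpow_neg, zpow_neg, ← inv_zpow]
  norm_num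
  ring

lemma thetaTerm_neg_arg (q z : ℂ) (m : ℤ) :
    thetaTerm q (-z) m = (-1) ^ m * thetaTerm q z m := by
  rw [thetaTerm, thetaTerm, neg_eq_neg_one_mul z, mul_zpow]; ring

lemma summable_norm_thetaTerm (hq : ‖q‖ < 1) (hq0 : q ≠ 0) {z : ℂ} (hz : z ≠ 0) :
    Summable fun m : ℤ ↦ ‖thetaTerm q z m‖ := by
  have key : ∀ z : ℂ, z ≠ 0 → Summable fun m : ℕ ↦ ‖thetaTerm q z m‖ := by
    intro z hz
    refine summable_norm_of_ratio_tendsto_zero (g := fun k ↦ -(q ^ k * z))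
      (fun k ↦ ?_) ?_
    · simpa using thetaTerm_add_one hq0 hz k
    · simpa using ((tendsto_pow_atTop_nhds_zero_of_norm_lt_one hq).mul_const z).neg
  refine Summable.of_nat_of_neg (key z hz) ?_
  simpa only [thetaTerm_neg hq0] using key (q / z) (div_ne_zero hq0 hz)

end Theta

section RealBase

variable {q : ℝ}

lemma norm_ofReal_lt_one (hq0 : 0 < q) (hq1 : q < 1) : ‖(q : ℂ)‖ < 1 := by
  rwa [Complex.norm_real, Real.norm_of_nonneg hq0.le]

lemma norm_qpInf_zpow_le_one (hq0 : 0 < q) (hq1 : q < 1) (j : ℤ) :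
    ‖qpInf (q : ℂ) ((q : ℂ) ^ j)‖ ≤ 1 := by
  have hq := norm_ofReal_lt_one hq0 hq1
  rcases le_or_gt j 0 with hj | hj
  · rw [qpInf_zpow_of_nonpos hq (by exact_mod_cast hq0.ne') hj]; simp
  · obtain ⟨m, rfl⟩ := Int.eq_ofNat_of_zero_le hj.le
    refine le_of_tendsto (tendsto_qp hq _).norm (.of_forall fun n ↦ ?_)
    rw [qp, norm_prod]
    refine Finset.prod_le_one (fun _ _ ↦ norm_nonneg _) fun k _ ↦ ?_
    have h0 : 0 ≤ q ^ m * q ^ k := by positivity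
    have h1 : q ^ m * q ^ k ≤ 1 :=
      mul_le_one₀ (pow_le_one₀ hq0.le hq1.le) (by positivity) (pow_le_one₀ hq0.le hq1.le)
    have : (1 - (q : ℂ) ^ (m : ℤ) * (q : ℂ) ^ k) = ((1 - q ^ m * q ^ k : ℝ) : ℂ) := by
      push_cast; simp
    rw [this, Complex.norm_real, Real.norm_of_nonneg (by linarith)]
    linarith

lemma summable_norm_thetaTerm_mul_qpInf (hq0 : 0 < q) (hq1 : q < 1) {z : ℂ} (hz : z ≠ 0)
    (n : ℤ) :
    Summable fun m : ℤ ↦ ‖thetaTerm q z m * qpInf (q : ℂ) ((q : ℂ) ^ (m + n))‖ := by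
  refine (summable_norm_thetaTerm (norm_ofReal_lt_one hq0 hq1)
    (by exact_mod_cast hq0.ne') hz).of_nonneg_of_le (fun _ ↦ norm_nonneg _) fun m ↦ ?_
  rw [norm_mul]
  exact mul_le_of_le_one_right (norm_nonneg _) (norm_qpInf_zpow_le_one hq0 hq1 _)

lemma tsum_thetaTerm_mul_qpInf_succ (hq0 : 0 < q) (hq1 : q < 1) {z : ℂ} (hz : z ≠ 0) (n : ℤ) :
    ∑' m : ℤ, thetaTerm q z m * qpInf (q : ℂ) ((q : ℂ) ^ (m + (n + 1)))
      = (1 - (q : ℂ) ^ n / z) *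
        ∑' m : ℤ, thetaTerm q z m * qpInf (q : ℂ) ((q : ℂ) ^ (m + n)) := by
  have hq := norm_ofReal_lt_one hq0 hq1
  have hqc : (q : ℂ) ≠ 0 := by exact_mod_cast hq0.ne'
  have h0 := (summable_norm_thetaTerm_mul_qpInf hq0 hq1 hz n).of_norm
  have h1 := (summable_norm_thetaTerm_mul_qpInf hq0 hq1 hz (n + 1)).of_norm
  have key : ∑' m : ℤ, thetaTerm q z m * qpInf (q : ℂ) ((q : ℂ) ^ (m + n))
      - ∑' m : ℤ, thetaTerm q z m * qpInf (q : ℂ) ((q : ℂ) ^ (m + (n + 1)))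
      = (q : ℂ) ^ n / z *
        ∑' m : ℤ, thetaTerm q z m * qpInf (q : ℂ) ((q : ℂ) ^ (m + n)) := by
    rw [← h0.tsum_sub h1, ← tsum_mul_left, ← (Equiv.addRight (1 : ℤ)).tsum_eq
      (fun m : ℤ ↦ (q : ℂ) ^ n / z * (thetaTerm q z m * qpInf (q : ℂ) ((q : ℂ) ^ (m + n))))]
    refine tsum_congr fun m ↦ ?_
    rw [Equiv.coe_addRight, thetaTerm_add_one hqc hz, qpInf_eq_one_sub_mul hq ((q : ℂ) ^ (m + n)),
      ← zpow_add_one₀ hqc, show m + 1 + n = m + n + 1 by ring, ← add_assoc m n 1, zpow_add₀ hqc m n]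
    field_simp
    ring
  linear_combination -key

lemma tsum_thetaTerm_mul_qpInf_one (hq0 : 0 < q) (hq1 : q < 1) (z : ℂ) :
    ∑' m : ℤ, thetaTerm q z m * qpInf (q : ℂ) ((q : ℂ) ^ (m + 1)) = qpInf q q * qpInf q z := by
  have hq := norm_ofReal_lt_one hq0 hq1
  have hqc : (q : ℂ) ≠ 0 := by exact_mod_cast hq0.ne'
  rw [← tsum_eulerTerm hq z, ← tsum_mul_left,
    ← (Nat.cast_injective (R := ℤ)).tsum_eq (f := fun m : ℤ ↦ _)]
  · refine tsum_congr fun k ↦ ?_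
    have h : (k : ℤ) * (k - 1) / 2 = ((k * (k - 1) / 2 : ℕ) : ℤ) := by
      rcases k with _ | k <;> simp
    rw [thetaTerm, eulerTerm, h]
    have := qpInf_pow_succ hq k
    simp only [zpow_natCast]
    rw [← Nat.cast_succ, zpow_natCast, this]
    ring
  · intro m hm
    by_contra h
    refine hm ?_
    have hm0 : m + 1 ≤ 0 := by
      by_contra hb
      exact h ⟨m.toNat, by omega⟩
    simp only
    rw [qpInf_zpow_of_nonpos hq hqc hm0, mul_zero]

/-- The Jacobi triple product identity. -/
theorem tsum_thetaTerm (hq0 : 0 < q) (hq1 : q < 1) {z : ℂ} (hz : z ≠ 0) :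
    ∑' m : ℤ, thetaTerm q z m = qpInf q q * theta q z := by
  have hq := norm_ofReal_lt_one hq0 hq1
  have iter : ∀ n : ℕ, ∑' m : ℤ, thetaTerm q z m * qpInf (q : ℂ) ((q : ℂ) ^ (m + (n + 1 : ℤ)))
      = qp q (q / z) n * (qpInf q q * qpInf q z) := by
    intro n
    induction n with
    | zero => simpa [qp_zero] using tsum_thetaTerm_mul_qpInf_one hq0 hq1 z
    | succ n ih =>
      rw [Nat.cast_succ, tsum_thetaTerm_mul_qpInf_succ hq0 hq1 hz, ih, qp_succ, ← Nat.cast_succ,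
        zpow_natCast, pow_succ']
      ring
  have h0 : Tendsto (fun n : ℕ ↦ ∑' m : ℤ,
      thetaTerm q z m * qpInf (q : ℂ) ((q : ℂ) ^ (m + (n + 1 : ℤ)))) atTop
      (𝓝 (∑' m : ℤ, thetaTerm q z m)) := by
    refine tendsto_tsum_of_dominated_convergence
      (summable_norm_thetaTerm hq (by exact_mod_cast hq0.ne') hz) ?_ ?_
    · intro m
      have h1 : Tendsto (fun k : ℕ ↦ qpInf (q : ℂ) ((q : ℂ) ^ (k + 1))) atTop (𝓝 1) := by
        simp only [qpInf_pow_succ hq]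
        have := (tendsto_const_nhds (x := qpInf (q : ℂ) q)).div (tendsto_qp hq q)
          (qpInf_self_ne_zero hq)
        rwa [div_self (qpInf_self_ne_zero hq)] at this
      have h2 : Tendsto (fun n : ℕ ↦ (m + n).toNat) atTop atTop :=
        tendsto_atTop_atTop.mpr fun b ↦ ⟨b + m.natAbs, fun a ha ↦ by omega⟩
      have h3 := (h1.comp h2).const_mul (thetaTerm q z m)
      rw [mul_one] at h3
      refine h3.congr' ?_
      filter_upwards [eventually_ge_atTop m.natAbs] with n hn
      have : m + (n + 1 : ℤ) = (((m + n).toNat + 1 : ℕ) : ℤ) := by omega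
      rw [this, zpow_natCast]
      rfl
    · refine .of_forall fun n m ↦ ?_
      rw [norm_mul]
      exact mul_le_of_le_one_right (norm_nonneg _) (norm_qpInf_zpow_le_one hq0 hq1 _)
  have h1 := (tendsto_qp hq (q / z)).mul_const (qpInf (q : ℂ) q * qpInf q z)
  rw [tendsto_nhds_unique h0 (h1.congr fun n ↦ (iter n).symm), theta]
  ring

lemma thetaTerm_sub_mul (hqc : (q : ℂ) ≠ 0) {u : ℂ} (hu : u ≠ 0) (n N : ℤ) (k : ℕ) :
    thetaTerm q u (N - k) *
      ((q : ℂ) ^ (k * (k - 1) / 2) * (u * (q : ℂ) ^ (n + 1)) ^ k / qp ((q : ℂ) ^ 2) ((q : ℂ) ^ 2) k)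
      = thetaTerm q u N * eulerTerm ((q : ℂ) ^ 2) ((q : ℂ) ^ (n + 2 - N)) k := by
  have key : thetaTerm q u (N - k) *
      ((q : ℂ) ^ (k * (k - 1) / 2) * (u * (q : ℂ) ^ (n + 1)) ^ k)
      = thetaTerm q u N *
        ((-1) ^ k * ((q : ℂ) ^ 2) ^ (k * (k - 1) / 2) * ((q : ℂ) ^ (n + 2 - N)) ^ k) := by
    induction k with
    | zero => simp
    | succ k ih =>
      have e : (q : ℂ) ^ (1 - (N - k)) * (q : ℂ) ^ (n + 1) = (q : ℂ) ^ k * (q : ℂ) ^ (n + 2 - N) := by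
        rw [← zpow_natCast, ← zpow_add₀ hqc, ← zpow_add₀ hqc]
        congr 1; ring
      rw [pow_succ_choose, pow_succ_choose, Nat.cast_succ, ← sub_sub, thetaTerm_sub_one hqc hu,
        pow_succ (u * _), pow_succ ((q : ℂ) ^ (n + 2 - N)), pow_succ (-1 : ℂ)]
      calc _ = (thetaTerm q u (N - k) *
            ((q : ℂ) ^ (k * (k - 1) / 2) * (u * (q : ℂ) ^ (n + 1)) ^ k)) *
            (-((q : ℂ) ^ (1 - (N - k)) * (q : ℂ) ^ (n + 1)) * (q : ℂ) ^ k) := by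
              field_simp
        _ = _ := by rw [ih, e]; ring
  rw [mul_div_assoc', key, eulerTerm, mul_div_assoc']

lemma hasSum_theta_mul (hq0 : 0 < q) (hq1 : q < 1) {u : ℂ} (hu : u ≠ 0) (n : ℤ) :
    HasSum (fun N : ℤ ↦ thetaTerm q u N * qpInf ((q : ℂ) ^ 2) ((q : ℂ) ^ (n + 2 - N)))
      (qpInf q q * theta q u * ∑' k : ℕ, (q : ℂ) ^ (k * (k - 1) / 2) *
        (u * (q : ℂ) ^ (n + 1)) ^ k / qp ((q : ℂ) ^ 2) ((q : ℂ) ^ 2) k) := by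
  have hq := norm_ofReal_lt_one hq0 hq1
  have hqc : (q : ℂ) ≠ 0 := by exact_mod_cast hq0.ne'
  have hq2 : ‖(q : ℂ) ^ 2‖ < 1 := by
    rw [norm_pow]; exact pow_lt_one₀ (norm_nonneg _) hq two_ne_zero
  set f : ℕ → ℂ := fun k ↦ (q : ℂ) ^ (k * (k - 1) / 2) *
    (u * (q : ℂ) ^ (n + 1)) ^ k / qp ((q : ℂ) ^ 2) ((q : ℂ) ^ 2) k with hf
  have hfs : Summable fun k ↦ ‖f k‖ := by
    refine summable_norm_of_ratio_tendsto_zero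
      (g := fun k ↦ (q : ℂ) ^ k * (u * (q : ℂ) ^ (n + 1)) / (1 - ((q : ℂ) ^ 2) ^ (k + 1)))
      (fun k ↦ ?_) ?_
    · have := one_sub_pow_succ_ne_zero hq2 k
      have := qp_self_ne_zero hq2 k
      simp only [hf]
      rw [pow_succ_choose, qp_self_succ, pow_succ (u * _)]
      field_simp
    · have h := tendsto_pow_atTop_nhds_zero_of_norm_lt_one hq
      have hb := tendsto_pow_atTop_nhds_zero_of_norm_lt_one hq2
      have h1 := (h.mul_const (u * (q : ℂ) ^ (n + 1))).div ((tendsto_const_nhds (x := (1 : ℂ))).sub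
        ((tendsto_add_atTop_iff_nat 1).mpr hb)) (by simp)
      simpa [Pi.div_def] using h1
  have hts := summable_norm_thetaTerm hq hqc hu
  let e : ℤ × ℕ ≃ ℤ × ℕ :=
    ⟨fun p ↦ (p.1 - p.2, p.2), fun p ↦ (p.1 + p.2, p.2), fun p ↦ by simp, fun p ↦ by simp⟩
  have hsum := summable_mul_of_summable_norm hts hfs
  have hprod : HasSum (fun p : ℤ × ℕ ↦ thetaTerm q u p.1 * f p.2)
      (qpInf q q * theta q u * ∑' k, f k) := by
    rw [← tsum_thetaTerm hq0 hq1 hu, tsum_mul_tsum_of_summable_norm hts hfs]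
    exact hsum.hasSum
  refine HasSum.prod_fiberwise (e.hasSum_iff.mpr hprod) fun N ↦ ?_
  have h := ((summable_norm_eulerTerm hq2 ((q : ℂ) ^ (n + 2 - N))).of_norm.hasSum).mul_left
    (thetaTerm q u N)
  rw [tsum_eulerTerm hq2] at h
  exact (funext fun k ↦ thetaTerm_sub_mul hqc hu n N k :
    (fun k : ℕ ↦ thetaTerm q u (N - k) * f k) = _) ▸ h

lemma qr_zpow (hq0 : 0 < q) (r : ℝ) (n : ℤ) : qr q r ^ n = qr q (r * n) := by
  rw [qr, qr, Real.rpow_mul hq0.le, Real.rpow_intCast, Complex.ofReal_zpow]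

lemma qr_mul (hq0 : 0 < q) (r s : ℝ) : qr q r * qr q s = qr q (r + s) := by
  rw [qr, qr, qr, Real.rpow_add hq0, Complex.ofReal_mul]

lemma qr_intCast (q : ℝ) (n : ℤ) : qr q n = (q : ℂ) ^ n := by
  rw [qr, Real.rpow_intCast, Complex.ofReal_zpow]

lemma qr_ne_zero (hq0 : 0 < q) (r : ℝ) : qr q r ≠ 0 := by
  rw [qr]; exact_mod_cast (Real.rpow_pos_of_pos hq0 r).ne'

lemma thetaTerm_sub_two_mul (hq0 : 0 < q) {x : ℂ} (hx : x ≠ 0) (n : ℤ) (j : ℕ) :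
    thetaTerm q (I * qr q (-(1 / 2)) * x) (n - 2 * j) * (I ^ n * qr q ((n : ℝ) / 2))
      = x ^ n * (q : ℂ) ^ (n * (n - 1) / 2) *
        ((q : ℂ) ^ (2 * (j * (j - 1))) * (-((q : ℂ) ^ (-2 * n + 4)) * x ^ (-2 : ℤ)) ^ j) := by
  have hqc : (q : ℂ) ≠ 0 := by exact_mod_cast hq0.ne'
  have hw : I * qr q (-(1 / 2)) * x ≠ 0 :=
    mul_ne_zero (mul_ne_zero I_ne_zero (qr_ne_zero hq0 _)) hx
  induction j with
  | zero =>
    have h1 : qr q (-(1 / 2)) ^ n * qr q ((n : ℝ) / 2) = 1 := by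
      rw [qr_zpow hq0, qr_mul hq0, show -(1 / 2) * (n : ℝ) + n / 2 = ((0 : ℤ) : ℝ) by
        push_cast; ring, qr_intCast, zpow_zero]
    have h2 : (-1 : ℂ) ^ n * (I ^ n * I ^ n) = 1 := by
      rw [← mul_zpow, ← mul_zpow, I_mul_I]; norm_num
    simp only [Nat.cast_zero, mul_zero, sub_zero, pow_zero, zero_mul, mul_one, thetaTerm, mul_zpow]
    linear_combination ((q : ℂ) ^ (n * (n - 1) / 2) * x ^ n) *
      (qr q (-(1 / 2)) ^ n * qr q ((n : ℝ) / 2) * h2 + h1)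
  | succ j ih =>
    have h1 : qr q (-(1 / 2)) * qr q (-(1 / 2)) = (q : ℂ)⁻¹ := by
      rw [qr_mul hq0, show -(1 / 2) + -(1 / 2) = ((-1 : ℤ) : ℝ) by norm_num, qr_intCast,
        zpow_neg_one]
    have hw2 : (I * qr q (-(1 / 2)) * x) * (I * qr q (-(1 / 2)) * x) = -((q : ℂ)⁻¹ * (x * x)) := by
      linear_combination (qr q (-(1 / 2)) * qr q (-(1 / 2)) * x * x) * I_mul_I - x * x * h1
    have hpow : (q : ℂ) ^ (2 * ((j + 1) * (j + 1 - 1))) =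
        (q : ℂ) ^ (2 * (j * (j - 1))) * (q : ℂ) ^ (4 * j) := by
      rw [← pow_add]
      congr 1
      rcases j with _ | j
      · rfl
      · simp only [Nat.add_sub_cancel]; ring
    have hexp : (q : ℂ) ^ (1 - (n - 2 * j)) * (q : ℂ) ^ (1 - (n - 2 * j - 1)) * q =
        (q : ℂ) ^ (4 * j) * (q : ℂ) ^ (-2 * n + 4) := by
      rw [← zpow_natCast, ← zpow_add₀ hqc, ← zpow_add_one₀ hqc, ← zpow_add₀ hqc]
      congr 1; push_cast; ring
    rw [show n - 2 * ((j + 1 : ℕ) : ℤ) = n - 2 * j - 1 - 1 by push_cast; ring,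
      thetaTerm_sub_one hqc hw, thetaTerm_sub_one hqc hw, hpow, pow_succ (_ * x ^ (-2 : ℤ))]
    set w := I * qr q (-(1 / 2)) * x
    have hx2 : x ^ (-2 : ℤ) = (x * x)⁻¹ := by
      rw [zpow_neg]; norm_cast; rw [pow_two]
    have hw3 : (w * w)⁻¹ = -(q * (x * x)⁻¹) := by
      rw [hw2, inv_neg, mul_inv, inv_inv]
    calc _ = thetaTerm q w (n - 2 * j) * (I ^ n * qr q ((n : ℝ) / 2)) *
          ((q : ℂ) ^ (1 - (n - 2 * j)) * (q : ℂ) ^ (1 - (n - 2 * j - 1)) * (w * w)⁻¹) := by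
            rw [mul_inv]; ring
      _ = _ := by
        rw [ih, hw3, ← hx2]
        linear_combination (-(x ^ n * (q : ℂ) ^ (n * (n - 1) / 2) *
          ((q : ℂ) ^ (2 * (j * (j - 1))) * (-((q : ℂ) ^ (-2 * n + 4)) * x ^ (-2 : ℤ)) ^ j)) *
          x ^ (-2 : ℤ)) * hexp

lemma psi_eq_tsum (hq0 : 0 < q) (s x : ℂ) (n : ℤ) :
    psi q s x n = (s * I) ^ n * qr q ((n : ℝ) / 2) *
      ∑' k : ℕ, (q : ℂ) ^ (k * (k - 1) / 2) *
        (s * (I * qr q (-(1 / 2)) * x) * (q : ℂ) ^ (n + 1)) ^ k /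
          qp ((q : ℂ) ^ 2) ((q : ℂ) ^ 2) k := by
  rw [psi]
  congr 1
  refine tsum_congr fun k ↦ ?_
  have h : qr q ((n : ℝ) + 1 / 2) = qr q (-(1 / 2)) * (q : ℂ) ^ (n + 1) := by
    rw [← qr_intCast, qr_mul hq0]
    congr 1; push_cast; ring
  rw [qp_mul_qp_neg, h, show -s * I * x * (qr q (-(1 / 2)) * (q : ℂ) ^ (n + 1))
    = -1 * (s * (I * qr q (-(1 / 2)) * x) * (q : ℂ) ^ (n + 1)) by ring, mul_pow (-1 : ℂ)]
  have h1 : (-1 : ℂ) ^ k * (-1) ^ k = 1 := by rw [← mul_pow]; norm_num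
  congr 1
  linear_combination ((q : ℂ) ^ (k * (k - 1) / 2) *
    (s * (I * qr q (-(1 / 2)) * x) * (q : ℂ) ^ (n + 1)) ^ k) * h1

end RealBase

theorem stmt_1 (q : ℝ) (hq0 : 0 < q) (hq1 : q < 1) (x : ℂ) (hx : x ≠ 0) (n : ℤ) :
    theta (q : ℂ) (-Complex.I * qr q (-(1 / 2)) * x) * psi q (-1) x n +
      theta (q : ℂ) (Complex.I * qr q (-(1 / 2)) * x) * psi q 1 x n
    = qpInf (q : ℂ) (-1) * x ^ n * (q : ℂ) ^ (n * (n - 1) / 2) *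
        ∑' k : ℕ, (q : ℂ) ^ (2 * (k * (k - 1))) *
          (-((q : ℂ) ^ (-2 * n + 4)) * x ^ (-2 : ℤ)) ^ k /
            qp ((q : ℂ) ^ 2) ((q : ℂ) ^ 2) k := by
  have hq := norm_ofReal_lt_one hq0 hq1
  have hqc : (q : ℂ) ≠ 0 := by exact_mod_cast hq0.ne'
  have hq2 : ‖(q : ℂ) ^ 2‖ < 1 := by
    rw [norm_pow]; exact pow_lt_one₀ (norm_nonneg _) hq two_ne_zero
  rw [psi_eq_tsum hq0, psi_eq_tsum hq0]
  have hw : I * qr q (-(1 / 2)) * x ≠ 0 :=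
    mul_ne_zero (mul_ne_zero I_ne_zero (qr_ne_zero hq0 _)) hx
  rw [show -I * qr q (-(1 / 2)) * x = -1 * (I * qr q (-(1 / 2)) * x) by ring]
  have hterm := fun j ↦ thetaTerm_sub_two_mul hq0 hx n j
  set w := I * qr q (-(1 / 2)) * x
  have hplus := (hasSum_theta_mul hq0 hq1 hw n).mul_left (I ^ n * qr q ((n : ℝ) / 2))
  have hminus := (hasSum_theta_mul hq0 hq1 (neg_ne_zero.mpr hw) n).mul_left
    ((-1 * I) ^ n * qr q ((n : ℝ) / 2))
  have hsum := (hminus.add hplus).tsum_eq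
  refine mul_left_cancel₀ (qpInf_self_ne_zero hq) ?_
  have hinj : Function.Injective fun j : ℕ ↦ n - 2 * (j : ℤ) := fun a b h ↦ by
    simp only at h; omega
  rw [← hinj.tsum_eq] at hsum
  · calc _ = _ := by rw [one_mul, one_mul, neg_one_mul w]; ring
      _ = _ := hsum.symm
      _ = (qpInf q (-1) * qpInf q q) * (x ^ n * (q : ℂ) ^ (n * (n - 1) / 2)) *
        ∑' k : ℕ, (q : ℂ) ^ (2 * (k * (k - 1))) *
          (-((q : ℂ) ^ (-2 * n + 4)) * x ^ (-2 : ℤ)) ^ k / qp ((q : ℂ) ^ 2) ((q : ℂ) ^ 2) k := by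
        rw [← tsum_mul_left]
        refine tsum_congr fun j ↦ ?_
        have hE : (q : ℂ) ^ (n + 2 - (n - 2 * (j : ℤ))) = ((q : ℂ) ^ 2) ^ (j + 1) := by
          rw [← pow_mul, ← zpow_natCast]; congr 1; push_cast; ring
        have hpar : (-1 : ℂ) ^ n * (-1) ^ (n - 2 * (j : ℤ)) = 1 := by
          rw [← zpow_add₀ (by norm_num)]
          exact Even.neg_one_zpow ⟨n - j, by ring⟩
        rw [hE, qpInf_pow_succ hq2, qpInf_neg_one_mul hq, thetaTerm_neg_arg, mul_zpow]
        have h := hterm j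
        linear_combination (qpInf ((q : ℂ) ^ 2) ((q : ℂ) ^ 2) / qp ((q : ℂ) ^ 2) ((q : ℂ) ^ 2) j) *
          (2 * h + (thetaTerm q w (n - 2 * j) * (I ^ n * qr q ((n : ℝ) / 2))) * hpar)
      _ = _ := by ring
  · intro N hN
    by_contra hr
    refine hN ?_
    simp only
    rcases Int.even_or_odd (n + N) with he | ho
    · obtain ⟨r, hr2⟩ := he
      have hE : (q : ℂ) ^ (n + 2 - N) = ((q : ℂ) ^ 2) ^ (n + 1 - r) := by
        rw [← zpow_natCast, ← zpow_mul]; congr 1; push_cast; omega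
      have hle : n + 1 - r ≤ 0 := by
        by_contra hb
        exact hr ⟨(n - r).toNat, by simp only; omega⟩
      rw [hE, qpInf_zpow_of_nonpos hq2 (pow_ne_zero 2 hqc) hle]
      ring
    · have hpar : (-1 : ℂ) ^ n * (-1) ^ N = -1 := by
        rw [← zpow_add₀ (by norm_num)]; exact ho.neg_one_zpow
      rw [thetaTerm_neg_arg, mul_zpow]
      linear_combination (I ^ n * qr q ((n : ℝ) / 2) *
        thetaTerm q w N * qpInf ((q : ℂ) ^ 2) ((q : ℂ) ^ (n + 2 - N))) * hpar
end

section
/- For every x ∈ ℂ \ {0}: the sequence φ(x) = {φ_n(x)}_{n∈ℤ} is not identically zero, it satisfies the three-term recurrence q^{−n+1} φ_{n−1}(x) + q^{−n} φ_{n+1}(x) = x φ_n(x) for all n ∈ ℤ, it is square summable, i.e. ∑_{n∈ℤ} |φ_n(x)|² < ∞, and it is the unique such solution up to a multiplicative constant: every sequence χ = {χ_n}_{n∈ℤ} satisfying q^{−n+1} χ_{n−1} + q^{−n} χ_{n+1} = x χ_n for all n ∈ ℤ with ∑_{n∈ℤ} |χ_n|² < ∞ equals c · φ(x) for some c ∈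 ℂ. -/
open Complex Filter Topology

/-- The square-summable solution φ_n(x). -/
noncomputable def phi (q : ℝ) (x : ℂ) (n : ℤ) : ℂ :=
  qpInf (q : ℂ) (-1) * x ^ n * (q : ℂ) ^ (n * (n - 1) / 2) *
    ∑' k : ℕ, (q : ℂ) ^ (2 * (k * (k - 1))) *
      (-((q : ℂ) ^ (-2 * n + 4)) * x ^ (-2 : ℤ)) ^ k /
        qp ((q : ℂ) ^ 2) ((q : ℂ) ^ 2) k

/-- The `k`-th term of the basic hypergeometric series occurring in `phi`. -/
noncomputable def phiTerm (q : ℝ) (w : ℂ) (k : ℕ) : ℂ :=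
  (q : ℂ) ^ (2 * (k * (k - 1))) * w ^ k / qp ((q : ℂ) ^ 2) ((q : ℂ) ^ 2) k

/-- The basic hypergeometric series occurring in `phi`. -/
noncomputable def phiSeries (q : ℝ) (w : ℂ) : ℂ := ∑' k : ℕ, phiTerm q w k

lemma phi_eq (q : ℝ) (x : ℂ) (n : ℤ) :
    phi q x n = qpInf (q : ℂ) (-1) * x ^ n * (q : ℂ) ^ (n * (n - 1) / 2) *
      phiSeries q (-((q : ℂ) ^ (-2 * n + 4)) * x ^ (-2 : ℤ)) := rfl

lemma one_sub_pow_ne_zero_of_lt_one {q : ℝ} (hq0 : 0 < q) (hq1 : q < 1) (k : ℕ) :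
    (1 - (q : ℂ) ^ (2 * k + 2)) ≠ 0 := by
  have h : q ^ (2 * k + 2) < 1 := pow_lt_one₀ hq0.le hq1 (by omega)
  have h' : (1 - q ^ (2 * k + 2) : ℝ) ≠ 0 := by linarith
  exact_mod_cast h'

lemma phiTerm_zero (q : ℝ) (w : ℂ) : phiTerm q w 0 = 1 := by
  simp [phiTerm, qp]

lemma phiTerm_succ (q : ℝ) (w : ℂ) (k : ℕ) :
    phiTerm q w (k + 1) =
      (q : ℂ) ^ (4 * k) * w / (1 - (q : ℂ) ^ (2 * k + 2)) * phiTerm q w k := by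
  have h : 2 * ((k + 1) * (k + 1 - 1)) = 4 * k + 2 * (k * (k - 1)) := by
    cases k with
    | zero => rfl
    | succ k => simp only [Nat.add_sub_cancel]; ring
  have h2 : (q : ℂ) ^ 2 * ((q : ℂ) ^ 2) ^ k = (q : ℂ) ^ (2 * k + 2) := by
    rw [← pow_mul, ← pow_add, add_comm]
  rw [phiTerm, phiTerm, h, qp, qp, Finset.prod_range_succ, h2, pow_add, pow_succ w,
    div_mul_div_comm]
  ring_nf

lemma phiTerm_mul (q : ℝ) (a w : ℂ) (k : ℕ) :
    phiTerm q (a * w) k = a ^ k * phiTerm q w k := by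
  rw [phiTerm, phiTerm, mul_pow]
  ring

lemma summable_phiTerm {q : ℝ} (hq0 : 0 < q) (hq1 : q < 1) (w : ℂ) :
    Summable (phiTerm q w) := by
  have hq : ‖(q : ℂ)‖ < 1 := by simpa [abs_of_pos hq0] using hq1
  have hp : Tendsto (fun k : ℕ => (q : ℂ) ^ k) atTop (𝓝 0) :=
    tendsto_pow_atTop_nhds_zero_of_norm_lt_one hq
  have h4 : Tendsto (fun k : ℕ => (q : ℂ) ^ (4 * k)) atTop (𝓝 0) :=
    hp.comp (tendsto_atTop_mono (fun k => by simp only [id]; omega) tendsto_id)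
  have h2 : Tendsto (fun k : ℕ => (q : ℂ) ^ (2 * k + 2)) atTop (𝓝 0) :=
    hp.comp (tendsto_atTop_mono (fun k => by simp only [id]; omega) tendsto_id)
  have h : Tendsto (fun k : ℕ => ‖(q : ℂ) ^ (4 * k) * w / (1 - (q : ℂ) ^ (2 * k + 2))‖)
      atTop (𝓝 0) := by
    have := ((h4.mul_const w).div (tendsto_const_nhds.sub h2) (by simp : (1 : ℂ) - 0 ≠ 0)).norm
    simpa using this
  refine summable_of_ratio_norm_eventually_le (r := 1 / 2) (by norm_num) ?_
  filter_upwards [h.eventually (ge_mem_nhds (by norm_num : (0 : ℝ) < 1 / 2))] with k hk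
  rw [phiTerm_succ, norm_mul]
  gcongr

lemma phiSeries_functional_equation {q : ℝ} (hq0 : 0 < q) (hq1 : q < 1) (v : ℂ) :
    phiSeries q v =
      phiSeries q ((q : ℂ) ^ 2 * v) + v * phiSeries q ((q : ℂ) ^ 4 * v) := by
  have hs := fun w => summable_phiTerm hq0 hq1 w
  rw [phiSeries, phiSeries, phiSeries, (hs v).tsum_eq_zero_add,
    (hs ((q : ℂ) ^ 2 * v)).tsum_eq_zero_add, phiTerm_zero, phiTerm_zero, add_assoc,
    ← tsum_mul_left, ← Summable.tsum_add ((summable_nat_add_iff 1).2 (hs _)) ((hs _).mul_left _)]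
  congr 2
  ext k
  have hk := one_sub_pow_ne_zero_of_lt_one hq0 hq1 k
  rw [phiTerm_mul, phiTerm_mul, phiTerm_succ]
  field_simp
  ring

lemma tendsto_phiSeries_zero {q : ℝ} (hq0 : 0 < q) (hq1 : q < 1) :
    Tendsto (phiSeries q) (𝓝 0) (𝓝 1) := by
  have h1 : ∑' k : ℕ, phiTerm q 0 k = 1 := by
    rw [tsum_eq_single 0, phiTerm_zero]
    intro k hk
    simp [phiTerm, hk]
  rw [← h1]
  refine tendsto_tsum_of_dominated_convergence (summable_phiTerm hq0 hq1 1).norm ?_ ?_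
  · intro k
    have : Continuous fun w => phiTerm q w k := by unfold phiTerm; fun_prop
    exact this.tendsto 0
  · filter_upwards [Metric.ball_mem_nhds (0 : ℂ) one_pos] with w hw k
    have hw' : ‖w‖ ≤ 1 := by simpa using (mem_ball_zero_iff.1 hw).le
    rw [← mul_one w, phiTerm_mul, norm_mul, norm_pow]
    exact mul_le_of_le_one_left (norm_nonneg _) (pow_le_one₀ (norm_nonneg _) hw')

lemma tendsto_phiSeries_neg {q : ℝ} (hq0 : 0 < q) (hq1 : q < 1) (x : ℂ) :
    Tendsto (fun m : ℕ => phiSeries q (-((q : ℂ) ^ (-2 * (-(m : ℤ)) + 4)) * x ^ (-2 : ℤ)))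
      atTop (𝓝 1) := by
  have hq : ‖(q : ℂ)‖ < 1 := by simpa [abs_of_pos hq0] using hq1
  have hp : Tendsto (fun k : ℕ => (q : ℂ) ^ k) atTop (𝓝 0) :=
    tendsto_pow_atTop_nhds_zero_of_norm_lt_one hq
  have h2 : Tendsto (fun k : ℕ => (q : ℂ) ^ (2 * k + 4)) atTop (𝓝 0) :=
    hp.comp (tendsto_atTop_mono (fun k => by simp only [id]; omega) tendsto_id)
  refine (tendsto_phiSeries_zero hq0 hq1).comp ?_
  have := h2.neg.mul_const (x ^ (-2 : ℤ))
  rw [neg_zero, zero_mul] at this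
  refine this.congr fun m => ?_
  rw [show -2 * (-(m : ℤ)) + 4 = ((2 * m + 4 : ℕ) : ℤ) by push_cast; ring, zpow_natCast]

lemma qpInf_neg_one_ne_zero {q : ℝ} (hq0 : 0 < q) (hq1 : q < 1) :
    qpInf (q : ℂ) (-1) ≠ 0 := by
  have h : qpInf (q : ℂ) (-1) = ∏' k : ℕ, (1 + (q : ℂ) ^ k) := by
    simp [qpInf]
  rw [h]
  refine tprod_one_add_ne_zero_of_summable (fun k => ?_) ?_
  · have : (1 + q ^ k : ℝ) ≠ 0 := by positivity
    exact_mod_cast this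
  · simpa [abs_of_pos hq0] using summable_geometric_of_lt_one hq0.le hq1

lemma succ_mul_div_two (n : ℤ) : (n + 1) * (n + 1 - 1) / 2 = n * (n - 1) / 2 + n := by
  rw [← Int.add_mul_ediv_right _ _ two_ne_zero]
  ring_nf

lemma phi_recurrence {q : ℝ} (hq0 : 0 < q) (hq1 : q < 1) {x : ℂ} (hx : x ≠ 0) (n : ℤ) :
    (q : ℂ) ^ (-n + 1) * phi q x (n - 1) + (q : ℂ) ^ (-n) * phi q x (n + 1) =
      x * phi q x n := by
  have hq : (q : ℂ) ≠ 0 := by exact_mod_cast hq0.ne'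
  have e1 := succ_mul_div_two n
  have e2 : n * (n - 1) / 2 = (n - 1) * (n - 1 - 1) / 2 + (n - 1) := by
    simpa using succ_mul_div_two (n - 1)
  have hv := phiSeries_functional_equation hq0 hq1
    (-((q : ℂ) ^ (-2 * (n + 1) + 4)) * x ^ (-2 : ℤ))
  have w1 : (q : ℂ) ^ 2 * (-((q : ℂ) ^ (-2 * (n + 1) + 4)) * x ^ (-2 : ℤ)) =
      -((q : ℂ) ^ (-2 * n + 4)) * x ^ (-2 : ℤ) := by
    rw [show -2 * n + 4 = (2 : ℕ) + (-2 * (n + 1) + 4) by push_cast; ring,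
      zpow_add₀ hq (2 : ℕ), zpow_natCast]
    ring
  have w2 : (q : ℂ) ^ 4 * (-((q : ℂ) ^ (-2 * (n + 1) + 4)) * x ^ (-2 : ℤ)) =
      -((q : ℂ) ^ (-2 * (n - 1) + 4)) * x ^ (-2 : ℤ) := by
    rw [show -2 * (n - 1) + 4 = (4 : ℕ) + (-2 * (n + 1) + 4) by push_cast; ring,
      zpow_add₀ hq (4 : ℕ), zpow_natCast]
    ring
  rw [w1, w2] at hv
  rw [phi_eq, phi_eq, phi_eq, hv, e1, e2]
  generalize phiSeries q (-((q : ℂ) ^ (-2 * n + 4)) * x ^ (-2 : ℤ)) = A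
  generalize phiSeries q (-((q : ℂ) ^ (-2 * (n - 1) + 4)) * x ^ (-2 : ℤ)) = B
  generalize (n - 1) * (n - 1 - 1) / 2 = e
  have p1 : (q : ℂ) ^ (-2 * (n + 1) + 4) = (q : ℂ) ^ 2 / ((q : ℂ) ^ n) ^ 2 := by
    rw [show -2 * (n + 1) + 4 = (2 : ℕ) - n * (2 : ℕ) by push_cast; ring, zpow_sub₀ hq,
      zpow_natCast, zpow_mul, zpow_natCast]
  have hqn : (q : ℂ) ^ n ≠ 0 := zpow_ne_zero _ hq
  have hqe : (q : ℂ) ^ e ≠ 0 := zpow_ne_zero _ hq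
  have hxn : x ^ n ≠ 0 := zpow_ne_zero _ hx
  rw [p1]
  simp only [zpow_add₀ hq, zpow_add₀ hx, zpow_sub₀ hq, zpow_sub₀ hx, zpow_neg, zpow_one]
  rw [show x ^ (2 : ℤ) = x ^ 2 by norm_cast]
  field_simp
  ring

lemma summable_sq_of_summable_norm {ι : Type*} {f : ι → ℂ} (hf : Summable fun i => ‖f i‖) :
    Summable fun i => ‖f i‖ ^ 2 := by
  have h := hf.mul_of_nonneg hf (fun _ => norm_nonneg _) (fun _ => norm_nonneg _)
  have hd : Function.Injective fun i : ι => (i, i) := fun i j hij => (Prod.mk.inj hij).1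
  simpa [Function.comp_def, sq] using h.comp_injective hd

lemma eq_of_recurrence {q : ℝ} (hq0 : 0 < q) {x : ℂ} {χ : ℤ → ℂ}
    (h : ∀ n : ℤ, (q : ℂ) ^ (-n + 1) * χ (n - 1) + (q : ℂ) ^ (-n) * χ (n + 1) = x * χ n)
    (n : ℤ) : χ (n + 1) = x * (q : ℂ) ^ n * χ n - q * χ (n - 1) := by
  have hq : (q : ℂ) ≠ 0 := by exact_mod_cast hq0.ne'
  have hqn : (q : ℂ) ^ n ≠ 0 := zpow_ne_zero _ hq
  have hn := h n
  rw [zpow_add₀ hq, zpow_neg, zpow_one] at hn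
  field_simp at hn
  linear_combination hn

lemma summable_norm_nat_of_recurrence {q : ℝ} (hq0 : 0 < q) (hq1 : q < 1) {x : ℂ} {χ : ℤ → ℂ}
    (h : ∀ n : ℤ, χ (n + 1) = x * (q : ℂ) ^ n * χ n - q * χ (n - 1)) :
    Summable fun n : ℕ => ‖χ n‖ := by
  set s := √q
  have hs0 : 0 < s := Real.sqrt_pos.2 hq0
  have hss : s * s = q := Real.mul_self_sqrt hq0.le
  have hs1 : s < 1 := by nlinarith
  have hM : Summable fun n : ℕ => ‖χ (n + 1)‖ + s * ‖χ n‖ := by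
    have hlim : Tendsto (fun n : ℕ => s + ‖x‖ * q ^ (n + 1)) atTop (𝓝 s) := by
      have := (((tendsto_pow_atTop_nhds_zero_of_lt_one hq0.le hq1).comp
        (tendsto_add_atTop_nat 1)).const_mul ‖x‖).const_add s
      simpa using this
    have hr : s < (s + 1) / 2 := by linarith
    refine summable_of_ratio_norm_eventually_le (r := (s + 1) / 2) (by linarith) ?_
    filter_upwards [hlim.eventually (ge_mem_nhds hr)] with n hn
    rw [Real.norm_of_nonneg (by positivity), Real.norm_of_nonneg (by positivity)]
    have hrec : ‖χ (n + 1 + 1)‖ ≤ ‖x‖ * q ^ (n + 1) * ‖χ (n + 1)‖ + q * ‖χ n‖ := by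
      have h1 := h (n + 1)
      rw [add_sub_cancel_right] at h1
      rw [h1]
      refine (norm_sub_le _ _).trans_eq ?_
      rw [norm_mul, norm_mul, norm_mul, norm_zpow, Complex.norm_of_nonneg hq0.le]
      norm_cast
    push_cast
    calc ‖χ (n + 1 + 1)‖ + s * ‖χ (n + 1)‖
        ≤ (‖x‖ * q ^ (n + 1) * ‖χ (n + 1)‖ + q * ‖χ n‖) + s * ‖χ (n + 1)‖ := by gcongr
      _ ≤ (s + ‖x‖ * q ^ (n + 1)) * (‖χ (n + 1)‖ + s * ‖χ n‖) := by
          have : 0 ≤ ‖x‖ * q ^ (n + 1) * (s * ‖χ n‖) := by positivity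
          rw [← hss] at this ⊢
          nlinarith
      _ ≤ (s + 1) / 2 * (‖χ (n + 1)‖ + s * ‖χ n‖) := by gcongr
  refine (summable_nat_add_iff 1).1 (hM.of_nonneg_of_le (fun _ => norm_nonneg _) fun n => ?_)
  push_cast
  have : 0 ≤ s * ‖χ n‖ := by positivity
  linarith

lemma summable_norm_phi_neg {q : ℝ} (hq0 : 0 < q) (hq1 : q < 1) {x : ℂ} (hx : x ≠ 0) :
    Summable fun m : ℕ => ‖phi q x (-(m : ℤ))‖ := by
  have hq : (q : ℂ) ≠ 0 := by exact_mod_cast hq0.ne'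
  set g : ℕ → ℂ := fun m => qpInf (q : ℂ) (-1) * x ^ (-(m : ℤ)) *
    (q : ℂ) ^ (-(m : ℤ) * (-(m : ℤ) - 1) / 2) with hg
  have hgs : ∀ m, g (m + 1) = x⁻¹ * (q : ℂ) ^ (m + 1) * g m := by
    intro m
    have e := succ_mul_div_two (-((m + 1 : ℕ) : ℤ))
    rw [show -((m + 1 : ℕ) : ℤ) + 1 = -(m : ℤ) by push_cast; ring] at e
    have e' : -((m + 1 : ℕ) : ℤ) * (-((m + 1 : ℕ) : ℤ) - 1) / 2 =
        -(m : ℤ) * (-(m : ℤ) - 1) / 2 + (m + 1 : ℕ) := by rw [e]; ring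
    simp only [hg]
    rw [e', zpow_add₀ hq, zpow_natCast,
      show -((m + 1 : ℕ) : ℤ) = -(m : ℤ) + -1 by push_cast; ring, zpow_add₀ hx, zpow_neg_one]
    ring
  have hgsum : Summable fun m => ‖g m‖ := by
    have hqn : ‖(q : ℂ)‖ < 1 := by simpa [abs_of_pos hq0] using hq1
    have h : Tendsto (fun m : ℕ => ‖x⁻¹ * (q : ℂ) ^ (m + 1)‖) atTop (𝓝 0) := by
      have := (((tendsto_pow_atTop_nhds_zero_of_norm_lt_one hqn).comp
        (tendsto_add_atTop_nat 1)).const_mul x⁻¹).norm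
      simpa only [mul_zero, norm_zero, Function.comp_def] using this
    refine summable_of_ratio_norm_eventually_le (r := 1 / 2) (by norm_num) ?_
    filter_upwards [h.eventually (ge_mem_nhds (by norm_num : (0 : ℝ) < 1 / 2))] with m hm
    rw [hgs, norm_norm, norm_norm, norm_mul]
    gcongr
  refine (hgsum.mul_left 2).of_norm_bounded_eventually_nat ?_
  filter_upwards [(tendsto_phiSeries_neg hq0 hq1 x).norm.eventually
    (ge_mem_nhds (by norm_num : ‖(1 : ℂ)‖ < 2))] with m hm
  rw [norm_norm, phi_eq, norm_mul, mul_comm]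
  gcongr

lemma exists_phi_ne_zero {q : ℝ} (hq0 : 0 < q) (hq1 : q < 1) {x : ℂ} (hx : x ≠ 0) :
    ∃ n : ℤ, phi q x n ≠ 0 := by
  have hq : (q : ℂ) ≠ 0 := by exact_mod_cast hq0.ne'
  obtain ⟨m, hm⟩ :=
    ((tendsto_phiSeries_neg hq0 hq1 x).eventually_ne one_ne_zero).exists
  refine ⟨-(m : ℤ), ?_⟩
  rw [phi_eq]
  exact mul_ne_zero (mul_ne_zero (mul_ne_zero (qpInf_neg_one_ne_zero hq0 hq1)
    (zpow_ne_zero _ hx)) (zpow_ne_zero _ hq)) hm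

lemma summable_phi {q : ℝ} (hq0 : 0 < q) (hq1 : q < 1) {x : ℂ} (hx : x ≠ 0) :
    Summable fun n : ℤ => ‖phi q x n‖ ^ 2 :=
  summable_sq_of_summable_norm <| Summable.of_nat_of_neg
    (summable_norm_nat_of_recurrence hq0 hq1
      (eq_of_recurrence hq0 (phi_recurrence hq0 hq1 hx)))
    (summable_norm_phi_neg hq0 hq1 hx)

lemma tendsto_sub_natCast_of_summable_sq {χ : ℤ → ℂ} (h : Summable fun n => ‖χ n‖ ^ 2) (n : ℤ) :
    Tendsto (fun m : ℕ => χ (n - m)) atTop (𝓝 0) := by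
  have hinj : Function.Injective fun m : ℕ => n - (m : ℤ) := fun a b hab => by
    simp only at hab
    omega
  have h0 := (h.comp_injective hinj).tendsto_atTop_zero
  rw [tendsto_zero_iff_norm_tendsto_zero]
  have := h0.sqrt
  simpa [Function.comp_def] using this

/-- The Casoratian of two square summable solutions of the recurrence vanishes. -/
lemma casoratian_eq_zero {q : ℝ} (hq0 : 0 < q) (hq1 : q < 1) {x : ℂ} {φ χ : ℤ → ℂ}
    (hφ : ∀ n : ℤ, φ (n + 1) = x * (q : ℂ) ^ n * φ n - q * φ (n - 1))
    (hχ : ∀ n : ℤ, χ (n + 1) = x * (q : ℂ) ^ n * χ n - q * χ (n - 1))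
    (sφ : Summable fun n => ‖φ n‖ ^ 2) (sχ : Summable fun n => ‖χ n‖ ^ 2) (n : ℤ) :
    φ n * χ (n + 1) - φ (n + 1) * χ n = 0 := by
  have key : ∀ m : ℕ, φ n * χ (n + 1) - φ (n + 1) * χ n =
      (q : ℂ) ^ m * (φ (n - m) * χ (n + 1 - m) - φ (n + 1 - m) * χ (n - m)) := by
    intro m
    induction m with
    | zero => simp
    | succ m ih =>
      have h1 := hφ (n - m)
      have h2 := hχ (n - m)
      rw [show n - (m : ℤ) + 1 = n + 1 - m by ring] at h1 h2
      rw [ih, h1, h2, show n - ((m + 1 : ℕ) : ℤ) = n - m - 1 by push_cast; ring,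
        show n + 1 - ((m + 1 : ℕ) : ℤ) = n - m by push_cast; ring]
      ring
  have hqn : ‖(q : ℂ)‖ < 1 := by simpa [abs_of_pos hq0] using hq1
  have hlim := (tendsto_pow_atTop_nhds_zero_of_norm_lt_one hqn).mul
    (((tendsto_sub_natCast_of_summable_sq sφ n).mul
      (tendsto_sub_natCast_of_summable_sq sχ (n + 1))).sub
    ((tendsto_sub_natCast_of_summable_sq sφ (n + 1)).mul
      (tendsto_sub_natCast_of_summable_sq sχ n)))
  simp only [← key, mul_zero, zero_mul] at hlim
  exact tendsto_nhds_unique tendsto_const_nhds hlim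

lemma eq_zero_of_recurrence {q : ℝ} (hq0 : 0 < q) {x : ℂ} {χ : ℤ → ℂ}
    (h : ∀ n : ℤ, χ (n + 1) = x * (q : ℂ) ^ n * χ n - q * χ (n - 1))
    {N : ℤ} (h0 : χ N = 0) (h1 : χ (N + 1) = 0) (n : ℤ) : χ n = 0 := by
  have hq : (q : ℂ) ≠ 0 := by exact_mod_cast hq0.ne'
  suffices H : χ n = 0 ∧ χ (n + 1) = 0 from H.1
  induction n using Int.inductionOn' (b := N) with
  | zero => exact ⟨h0, h1⟩
  | succ k _ ih =>
    refine ⟨ih.2, ?_⟩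
    rw [h (k + 1), add_sub_cancel_right, ih.1, ih.2]
    simp
  | pred k _ ih =>
    have hk := h k
    rw [ih.1, ih.2] at hk
    rw [sub_add_cancel]
    refine ⟨?_, ih.1⟩
    simpa [hq] using hk

theorem stmt_2 (q : ℝ) (hq0 : 0 < q) (hq1 : q < 1) (x : ℂ) (hx : x ≠ 0) :
    (∃ n : ℤ, phi q x n ≠ 0) ∧
    (∀ n : ℤ,
      (q : ℂ) ^ (-n + 1) * phi q x (n - 1) + (q : ℂ) ^ (-n) * phi q x (n + 1)
        = x * phi q x n) ∧
    Summable (fun n : ℤ => ‖phi q x n‖ ^ 2) ∧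
    (∀ χ : ℤ → ℂ,
      (∀ n : ℤ, (q : ℂ) ^ (-n + 1) * χ (n - 1) + (q : ℂ) ^ (-n) * χ (n + 1) = x * χ n) →
      Summable (fun n : ℤ => ‖χ n‖ ^ 2) →
      ∃ c : ℂ, ∀ n : ℤ, χ n = c * phi q x n) := by
  have hrec := phi_recurrence hq0 hq1 hx
  refine ⟨exists_phi_ne_zero hq0 hq1 hx, hrec, summable_phi hq0 hq1 hx, fun χ hχ sχ => ?_⟩
  obtain ⟨N, hN⟩ := exists_phi_ne_zero hq0 hq1 hx
  have h1 := eq_of_recurrence hq0 hrec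
  have h2 := eq_of_recurrence hq0 hχ
  have hW := casoratian_eq_zero hq0 hq1 h1 h2 (summable_phi hq0 hq1 hx) sχ N
  refine ⟨χ N / phi q x N, fun n => sub_eq_zero.1 ?_⟩
  refine eq_zero_of_recurrence (χ := fun n => χ n - χ N / phi q x N * phi q x n) (N := N) (x := x)
    hq0 (fun k => ?_) ?_ ?_ n
  · simp only [h1 k, h2 k]
    ring
  · field_simp
    ring
  · field_simp
    linear_combination hW
end

section
/- For every z ∈ ℂ with z ≠ 0 and z ∉ {−q^{n+1/2} : n ∈ ℤ}, the bilateral series ∑_{n=−∞}^{∞} q^{n/2} / (1 + z q^{n−1/2}) converges and equals ((q;q)_∞² / (q^{1/2};q)_∞²) · θ_q(−z) / θ_q(−q^{−1/2} z). -/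
open Complex Filter Topology

open Finset in
/-- Finite q-Pochhammer symbol `(a;q)_n`. -/
noncomputable def qpFin (q a : ℂ) (n : ℕ) : ℂ := ∏ k ∈ range n, (1 - a * q ^ k)

section FiniteIdentity

open Finset

lemma prod_range_erase (g : ℕ → ℂ) (j l : ℕ) :
    ∏ k ∈ (range (j + l + 1)).erase j, g k =
      (∏ k ∈ range j, g k) * ∏ k ∈ range l, g (j + 1 + k) := by
  have hj : j ∈ range (j + l + 1) := by simp
  have h1 : ∏ k ∈ (range (j + l + 1)).erase j, g k =
      ∏ k ∈ range (j + 1 + l), if k = j then 1 else g k := by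
    rw [show j + 1 + l = j + l + 1 by ring, ← mul_prod_erase _ _ hj, if_pos rfl, one_mul]
    exact prod_congr rfl fun k hk => (if_neg (ne_of_mem_erase hk)).symm
  rw [h1, prod_range_add, prod_range_succ, if_pos rfl, mul_one]
  congr 1
  · exact prod_congr rfl fun k hk => if_neg (mem_range.mp hk).ne
  · exact prod_congr rfl fun k _ => if_neg (by omega)

lemma prod_sub_mul_pow (q b s : ℂ) (hb : b ≠ 0) (N : ℕ) :
    ∏ k ∈ range N, (s * q ^ N - b * q ^ k) =
      b ^ N * (∏ k ∈ range N, -q ^ (N - 1 - k)) * qpFin q (s * q / b) N := by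
  have hbN : b ^ N = ∏ _k ∈ range N, b := by simp
  rw [← prod_range_reflect, qpFin, hbN, ← prod_mul_distrib, ← prod_mul_distrib]
  refine prod_congr rfl fun k hk => ?_
  have hk : N = N - 1 - k + k + 1 := by have := mem_range.mp hk; omega
  have h : q ^ N = q ^ (N - 1 - k) * q ^ k * q := by
    rw [← pow_add, ← pow_succ, ← hk]
  rw [h]
  field_simp
  ring

lemma prod_sub_mul_pow_add (q b s : ℂ) (hs : s ≠ 0) (N l : ℕ) :
    ∏ k ∈ range l, (s * q ^ N - b * q ^ (N + k)) =
      (s * q ^ N) ^ l * qpFin q (b / s) l := by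
  have hl : (s * q ^ N) ^ l = ∏ _k ∈ range l, s * q ^ N := by simp
  rw [qpFin, hl, ← prod_mul_distrib]
  refine prod_congr rfl fun k _ => ?_
  rw [pow_add]
  field_simp

lemma nodalWeight_mul_prod (p : ℂ) (hp : p ≠ 0) (j l : ℕ) :
    Lagrange.nodalWeight (range (j + l + 1)) (fun k => (p ^ 2) ^ k) j *
      ∏ k ∈ range (j + l), ((p ^ 2) ^ j - p * (p ^ 2) ^ k) =
    p ^ j * (qpFin (p ^ 2) p j / qpFin (p ^ 2) (p ^ 2) j) *
      (qpFin (p ^ 2) p l / qpFin (p ^ 2) (p ^ 2) l) := by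
  set q := p ^ 2 with hq
  have hq0 : q ≠ 0 := pow_ne_zero _ hp
  have hc : ∏ k ∈ range j, -q ^ (j - 1 - k) ≠ 0 :=
    prod_ne_zero_iff.mpr fun k _ => neg_ne_zero.mpr (pow_ne_zero _ hq0)
  have hpow : (q ^ j) ^ l ≠ 0 := pow_ne_zero _ (pow_ne_zero _ hq0)
  have h1 := prod_sub_mul_pow q p 1 hp j
  have h2 := prod_sub_mul_pow q 1 1 one_ne_zero j
  have h3 := prod_sub_mul_pow_add q p 1 one_ne_zero j l
  have h4 := prod_sub_mul_pow_add q q 1 one_ne_zero j l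
  have hqp : q / p = p := by rw [hq]; field_simp
  simp only [one_mul, one_pow, div_one, hqp] at h1 h2 h3 h4
  have h4' : ∏ k ∈ range l, (q ^ j - q ^ (j + 1 + k)) = (q ^ j) ^ l * qpFin q q l := by
    rw [← h4]
    exact prod_congr rfl fun k _ => by ring
  rw [Lagrange.nodalWeight, prod_inv_distrib, prod_range_erase, prod_range_add, h1, h2, h3, h4']
  field_simp

lemma sum_nodes (p y : ℂ) (hp : p ≠ 0) (hinj : Function.Injective fun k : ℕ => (p ^ 2) ^ k)
    (M : ℕ) (hy : ∀ k : ℕ, y ≠ (p ^ 2) ^ k) :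
    ∏ k ∈ range M, (y - p * (p ^ 2) ^ k) =
      (∏ k ∈ range (M + 1), (y - (p ^ 2) ^ k)) *
        ∑ j ∈ range (M + 1), p ^ j * (qpFin (p ^ 2) p j / qpFin (p ^ 2) (p ^ 2) j) *
          (qpFin (p ^ 2) p (M - j) / qpFin (p ^ 2) (p ^ 2) (M - j)) / (y - (p ^ 2) ^ j) := by
  have hdeg : (Lagrange.nodal (range M) fun k => p * (p ^ 2) ^ k).degree
      < #(range (M + 1)) := by
    rw [Lagrange.degree_nodal, card_range, card_range]
    exact_mod_cast Nat.lt_succ_self M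
  have h := congrArg (Polynomial.eval y)
    (Lagrange.eq_interpolate (s := range (M + 1)) (v := fun k : ℕ => (p ^ 2) ^ k)
      hinj.injOn hdeg)
  rw [Lagrange.eval_interpolate_not_at_node _ fun k _ => hy k] at h
  simp only [Lagrange.eval_nodal] at h
  rw [h]
  congr 1
  refine sum_congr rfl fun j hj => ?_
  obtain ⟨l, rfl⟩ := Nat.exists_eq_add_of_le (Nat.lt_succ_iff.mp (mem_range.mp hj))
  rw [Nat.add_sub_cancel_left, ← nodalWeight_mul_prod p hp j l]
  ring

lemma sum_Icc_eq_sum_range (f : ℤ → ℂ) (N : ℕ) :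
    ∑ n ∈ Icc (-N : ℤ) N, f n = ∑ j ∈ range (2 * N + 1), f (j - N) := by
  symm
  refine sum_bij (fun j _ => (j : ℤ) - N) ?_ ?_ ?_ ?_
  · intro j hj; simp at hj ⊢; omega
  · intro i _ j _ h; simpa using h
  · intro n hn
    simp at hn
    exact ⟨(n + N).toNat, by simp; omega, by omega⟩
  · intros; rfl

/-- The bilateral sum truncated to `[-N, N]`. -/
lemma finite_kronecker (p x : ℂ) (hp : p ≠ 0) (hx : x ≠ 0)
    (hinj : Function.Injective fun k : ℕ => (p ^ 2) ^ k)
    (hxn : ∀ n : ℤ, 1 - x * (p ^ 2) ^ n ≠ 0) (N : ℕ) :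
    qpFin (p ^ 2) (x * p) N * qpFin (p ^ 2) (p ^ 2 / (x * p)) N =
      qpFin (p ^ 2) x (N + 1) * qpFin (p ^ 2) (p ^ 2 / x) N *
        ∑ n ∈ Icc (-N : ℤ) N, p ^ n / (1 - x * (p ^ 2) ^ n) *
          (qpFin (p ^ 2) p (N + n).toNat / qpFin (p ^ 2) (p ^ 2) (N + n).toNat) *
          (qpFin (p ^ 2) p (N - n).toNat / qpFin (p ^ 2) (p ^ 2) (N - n).toNat) := by
  have hq0 : p ^ 2 ≠ 0 := pow_ne_zero _ hp
  have hy : ∀ k : ℕ, x⁻¹ * (p ^ 2) ^ N ≠ (p ^ 2) ^ k := by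
    intro k hk
    apply hxn (k - N)
    rw [zpow_sub₀ hq0, zpow_natCast, zpow_natCast, ← hk]
    field_simp
    simp
  have h := sum_nodes p _ hp hinj (2 * N) hy
  have h1 := prod_sub_mul_pow (p ^ 2) p x⁻¹ hp N
  have h2 := prod_sub_mul_pow (p ^ 2) 1 x⁻¹ one_ne_zero N
  have h3 := prod_sub_mul_pow_add (p ^ 2) p x⁻¹ (inv_ne_zero hx) N N
  have h4 := prod_sub_mul_pow_add (p ^ 2) 1 x⁻¹ (inv_ne_zero hx) N (N + 1)
  simp only [one_mul, one_pow, div_one] at h2 h4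
  rw [show 2 * N + 1 = N + (N + 1) by ring, prod_range_add, h2, h4, two_mul, prod_range_add,
    h1, h3, ← two_mul, show N + (N + 1) = 2 * N + 1 by ring] at h
  have hsum : ∑ n ∈ Icc (-N : ℤ) N, p ^ n / (1 - x * (p ^ 2) ^ n) *
          (qpFin (p ^ 2) p (N + n).toNat / qpFin (p ^ 2) (p ^ 2) (N + n).toNat) *
          (qpFin (p ^ 2) p (N - n).toNat / qpFin (p ^ 2) (p ^ 2) (N - n).toNat) =
      (p ^ N)⁻¹ * (x⁻¹ * (p ^ 2) ^ N) *
        ∑ j ∈ range (2 * N + 1), p ^ j * (qpFin (p ^ 2) p j / qpFin (p ^ 2) (p ^ 2) j) *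
          (qpFin (p ^ 2) p (2 * N - j) / qpFin (p ^ 2) (p ^ 2) (2 * N - j)) /
            (x⁻¹ * (p ^ 2) ^ N - (p ^ 2) ^ j) := by
    rw [sum_Icc_eq_sum_range, mul_sum]
    refine sum_congr rfl fun j hj => ?_
    have e1 : ((N : ℤ) + (j - N)).toNat = j := by omega
    have e2 : ((N : ℤ) - (j - N)).toNat = 2 * N - j := by omega
    have e3 : p ^ ((j : ℤ) - N) = p ^ j / p ^ N := by
      rw [zpow_sub₀ hp, zpow_natCast, zpow_natCast]
    have e4 : (p ^ 2) ^ ((j : ℤ) - N) = (p ^ 2) ^ j / (p ^ 2) ^ N := by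
      rw [zpow_sub₀ hq0, zpow_natCast, zpow_natCast]
    have h5 := hxn (j - N)
    have h6 : x⁻¹ * (p ^ 2) ^ N - (p ^ 2) ^ j ≠ 0 := sub_ne_zero.mpr (hy j)
    have e5 : (1 - x * (p ^ 2) ^ ((j : ℤ) - N))⁻¹ =
        x⁻¹ * (p ^ 2) ^ N * (x⁻¹ * (p ^ 2) ^ N - (p ^ 2) ^ j)⁻¹ := by
      rw [inv_eq_iff_eq_inv, mul_inv, inv_inv, e4, ← div_eq_inv_mul,
        eq_div_iff (mul_ne_zero (inv_ne_zero hx) (pow_ne_zero _ hq0)), sub_mul]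
      have := pow_ne_zero N hq0
      generalize (p ^ 2) ^ N = Q at *
      field_simp
    rw [e1, e2, e3, div_eq_mul_inv _ (1 - _), e5]
    ring
  rw [hsum]
  have hc : ∏ k ∈ range N, -(p ^ 2) ^ (N - 1 - k) ≠ 0 :=
    prod_ne_zero_iff.mpr fun k _ => neg_ne_zero.mpr (pow_ne_zero _ hq0)
  have hpow : (x⁻¹ * (p ^ 2) ^ N) ^ N ≠ 0 :=
    pow_ne_zero _ (mul_ne_zero (inv_ne_zero hx) (pow_ne_zero _ hq0))
  have hpN : p ^ N ≠ 0 := pow_ne_zero _ hp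
  rw [show p / x⁻¹ = x * p by field_simp, show 1 / x⁻¹ = x by simp,
    show x⁻¹ * p ^ 2 / p = p ^ 2 / (x * p) by field_simp,
    show x⁻¹ * p ^ 2 = p ^ 2 / x by field_simp] at h
  apply mul_left_cancel₀ (mul_ne_zero (mul_ne_zero hpN hc) hpow)
  rw [pow_succ _ N] at h
  have hinv := mul_inv_cancel₀ hpN
  generalize (∏ k ∈ range N, -(p ^ 2) ^ (N - 1 - k)) = c at h ⊢
  generalize (x⁻¹ * (p ^ 2) ^ N) ^ N = d at h ⊢
  generalize (∑ j ∈ range (2 * N + 1), p ^ j * (qpFin (p ^ 2) p j / qpFin (p ^ 2) (p ^ 2) j) *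
    (qpFin (p ^ 2) p (2 * N - j) / qpFin (p ^ 2) (p ^ 2) (2 * N - j)) /
      (x⁻¹ * (p ^ 2) ^ N - (p ^ 2) ^ j)) = S at h ⊢
  generalize x⁻¹ * (p ^ 2) ^ N = e at h ⊢
  generalize p ^ N = P at h hinv ⊢
  linear_combination h - c * d * e * S * qpFin (p ^ 2) x (N + 1) *
    qpFin (p ^ 2) (p ^ 2 / x) N * hinv

end FiniteIdentity

lemma summable_mul_pow {q : ℂ} (hq : ‖q‖ < 1) (a : ℂ) :
    Summable fun k : ℕ => ‖-(a * q ^ k)‖ := by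
  simpa using (summable_geometric_of_lt_one (norm_nonneg _) hq).mul_left ‖a‖

lemma tendsto_qpFin {q : ℂ} (hq : ‖q‖ < 1) (a : ℂ) :
    Tendsto (qpFin q a) atTop (𝓝 (qpInf q a)) := by
  have h := (multipliable_one_add_of_summable (summable_mul_pow hq a)).hasProd.tendsto_prod_nat
  simp only [← sub_eq_add_neg] at h
  exact h

lemma qpInf_ne_zero {q a : ℂ} (hq : ‖q‖ < 1) (ha : ∀ k : ℕ, 1 - a * q ^ k ≠ 0) :
    qpInf q a ≠ 0 := by
  have h := tprod_one_add_ne_zero_of_summable (f := fun k : ℕ => -(a * q ^ k))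
    (fun k => by simpa only [← sub_eq_add_neg] using ha k) (summable_mul_pow hq a)
  simp only [← sub_eq_add_neg] at h
  exact h

lemma one_sub_mul_pow_ne_zero {q a : ℂ} (hq : ‖q‖ < 1) (ha : ‖a‖ < 1) (k : ℕ) :
    1 - a * q ^ k ≠ 0 := by
  intro h
  have h1 : ‖a * q ^ k‖ < 1 := by
    rw [norm_mul, norm_pow]
    exact (mul_le_of_le_one_right (norm_nonneg _)
      (pow_le_one₀ (norm_nonneg _) hq.le)).trans_lt ha
  rw [← sub_eq_zero.mp h, norm_one] at h1
  exact lt_irrefl _ h1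

lemma summable_mul_of_tendsto {p : ℂ} (hp : ‖p‖ < 1) {u : ℕ → ℂ} {c : ℂ}
    (hu : Tendsto u atTop (𝓝 c)) : Summable fun n : ℕ => p ^ n * u n := by
  obtain ⟨C, hC⟩ := (Metric.isBounded_range_of_tendsto u hu).exists_norm_le
  refine Summable.of_norm_bounded
    ((summable_geometric_of_lt_one (norm_nonneg _) hp).mul_right C) fun n => ?_
  rw [norm_mul, norm_pow]
  exact mul_le_mul_of_nonneg_left (hC _ ⟨n, rfl⟩) (by positivity)

lemma summable_kronecker {p x : ℂ} (hp : p ≠ 0) (hp1 : ‖p‖ < 1) (hx : x ≠ 0) :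
    Summable fun n : ℤ => p ^ n / (1 - x * (p ^ 2) ^ n) := by
  have hq1 : ‖p ^ 2‖ < 1 := by
    rw [norm_pow]; exact pow_lt_one₀ (norm_nonneg _) hp1 two_ne_zero
  have hlim := tendsto_pow_atTop_nhds_zero_of_norm_lt_one hq1
  refine Summable.of_nat_of_neg ?_ ?_
  · have hu : Tendsto (fun n : ℕ => (1 - x * (p ^ 2) ^ n)⁻¹) atTop (𝓝 (1 - x * 0)⁻¹) :=
      (tendsto_const_nhds.sub (hlim.const_mul x)).inv₀ (by simp)
    simpa only [zpow_natCast, div_eq_mul_inv] using summable_mul_of_tendsto hp1 hu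
  · have hu : Tendsto (fun n : ℕ => ((p ^ 2) ^ n - x)⁻¹) atTop (𝓝 (0 - x)⁻¹) :=
      (hlim.sub tendsto_const_nhds).inv₀ (by simpa using hx)
    refine (summable_mul_of_tendsto hp1 hu).congr fun n => ?_
    have hpn : p ^ n ≠ 0 := pow_ne_zero _ hp
    have h : 1 - x * ((p ^ 2) ^ n)⁻¹ = ((p ^ 2) ^ n)⁻¹ * ((p ^ 2) ^ n - x) := by
      field_simp
    rw [zpow_neg, zpow_neg, zpow_natCast, zpow_natCast, h, div_eq_mul_inv, mul_inv, inv_inv,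
      ← mul_assoc]
    congr 1
    rw [← pow_mul, mul_comm 2 n, pow_mul]
    field_simp

/-- Kronecker's bilateral series `∑ yⁿ / (1 - x qⁿ)` at `y = p`, `q = p²`. -/
lemma hasSum_kronecker {p x : ℂ} (hp : p ≠ 0) (hp1 : ‖p‖ < 1) (hx : x ≠ 0)
    (hxn : ∀ n : ℤ, 1 - x * (p ^ 2) ^ n ≠ 0) :
    HasSum (fun n : ℤ => p ^ n / (1 - x * (p ^ 2) ^ n))
      (qpInf (p ^ 2) (p ^ 2) ^ 2 / qpInf (p ^ 2) p ^ 2 *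
        (theta (p ^ 2) (x * p) / theta (p ^ 2) x)) := by
  set q := p ^ 2 with hq
  have hq0 : q ≠ 0 := pow_ne_zero _ hp
  have hq1 : ‖q‖ < 1 := by
    rw [hq, norm_pow]; exact pow_lt_one₀ (norm_nonneg _) hp1 two_ne_zero
  have hinj : Function.Injective fun k : ℕ => q ^ k := by
    intro i j hij
    have := congrArg norm hij
    simp only [norm_pow] at this
    exact (pow_right_strictAnti₀ (norm_pos_iff.mpr hq0) hq1).injective this
  have hsum := summable_kronecker hp hp1 hx
  have hqq : qpInf q q ≠ 0 := qpInf_ne_zero hq1 (one_sub_mul_pow_ne_zero hq1 hq1)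
  have hqp : qpInf q p ≠ 0 := qpInf_ne_zero hq1 (one_sub_mul_pow_ne_zero hq1 hp1)
  have hx1 : qpInf q x ≠ 0 := qpInf_ne_zero hq1 fun k => by simpa using hxn k
  have hx2 : qpInf q (q / x) ≠ 0 := by
    refine qpInf_ne_zero hq1 fun k h => hxn (-(k + 1 : ℕ)) ?_
    have hxq : x = q * q ^ k := by
      field_simp at h
      linear_combination h
    rw [zpow_neg, zpow_natCast, pow_succ', ← hxq, mul_inv_cancel₀ hx, sub_self]
  set a : ℕ → ℂ := fun m => qpFin q p m / qpFin q q m with ha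
  have hlim : Tendsto a atTop (𝓝 (qpInf q p / qpInf q q)) :=
    (tendsto_qpFin hq1 p).div (tendsto_qpFin hq1 q) hqq
  obtain ⟨C, hC⟩ := (Metric.isBounded_range_of_tendsto a hlim).exists_norm_le
  have hC' : ∀ m, ‖a m‖ ≤ C := fun m => hC _ ⟨m, rfl⟩
  have hC0 : 0 ≤ C := (norm_nonneg _).trans (hC' 0)
  set F : ℕ → ℤ → ℂ := fun N n => if n ∈ Finset.Icc (-N : ℤ) N then
    p ^ n / (1 - x * q ^ n) * a (N + n).toNat * a (N - n).toNat else 0 with hF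
  have hT : Tendsto (fun N => ∑' n, F N n) atTop
      (𝓝 (∑' n : ℤ, p ^ n / (1 - x * q ^ n) * (qpInf q p / qpInf q q) *
        (qpInf q p / qpInf q q))) := by
    refine tendsto_tsum_of_dominated_convergence
      (bound := fun n : ℤ => ‖p ^ n / (1 - x * q ^ n)‖ * C * C)
      ((hsum.norm.mul_right C).mul_right C) (fun n => ?_) (Eventually.of_forall fun N n => ?_)
    · have h1 : Tendsto (fun N : ℕ => ((N : ℤ) + n).toNat) atTop atTop :=
        tendsto_atTop.mpr fun b => by
          filter_upwards [eventually_ge_atTop (b + n.natAbs)] with N hN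
          omega
      have h2 : Tendsto (fun N : ℕ => ((N : ℤ) - n).toNat) atTop atTop :=
        tendsto_atTop.mpr fun b => by
          filter_upwards [eventually_ge_atTop (b + n.natAbs)] with N hN
          omega
      refine (((hlim.comp h1).const_mul _).mul (hlim.comp h2)).congr' ?_
      filter_upwards [eventually_ge_atTop n.natAbs] with N hN
      have : n ∈ Finset.Icc (-N : ℤ) N := by rw [Finset.mem_Icc]; omega
      simp only [hF, if_pos this, Function.comp]
    · simp only [hF]
      split_ifs
      · rw [norm_mul, norm_mul]
        gcongr
        · exact hC' _
        · exact hC' _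
      · rw [norm_zero]; positivity
  have hfin : ∀ N : ℕ, qpFin q (x * p) N * qpFin q (q / (x * p)) N =
      qpFin q x (N + 1) * qpFin q (q / x) N * ∑' n, F N n := by
    intro N
    rw [finite_kronecker p x hp hx hinj hxn N, tsum_eq_sum (s := Finset.Icc (-N : ℤ) N)
      fun n hn => by simp only [hF, if_neg hn]]
    congr 1
    exact Finset.sum_congr rfl fun n hn => by simp only [hF, if_pos hn, ha, hq]
  have hlim1 := (tendsto_qpFin hq1 (x * p)).mul (tendsto_qpFin hq1 (q / (x * p)))
  have hlim2 := ((((tendsto_qpFin hq1 x).comp (tendsto_add_atTop_nat 1)).mul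
    (tendsto_qpFin hq1 (q / x))).mul hT)
  have heq := tendsto_nhds_unique hlim1 (hlim2.congr fun N => (hfin N).symm)
  rw [tsum_mul_right, tsum_mul_right] at heq
  convert hsum.hasSum using 1
  rw [theta, theta, heq]
  generalize ∑' n : ℤ, p ^ n / (1 - x * q ^ n) = S
  field_simp

theorem stmt_3 (q : ℝ) (hq0 : 0 < q) (hq1 : q < 1) (z : ℂ) (hz : z ≠ 0)
    (hz' : ∀ n : ℤ, z ≠ -qr q ((n : ℝ) + 1 / 2)) :
    HasSum (fun n : ℤ => qr q ((n : ℝ) / 2) / (1 + z * qr q ((n : ℝ) - 1 / 2)))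
      (qpInf (q : ℂ) (q : ℂ) ^ 2 / qpInf (q : ℂ) (qr q (1 / 2)) ^ 2 *
        (theta (q : ℂ) (-z) / theta (q : ℂ) (-(qr q (-(1 / 2)) * z)))) := by
  have qr_add : ∀ a b : ℝ, qr q (a + b) = qr q a * qr q b := fun a b => by
    simp only [qr, Real.rpow_add hq0, ofReal_mul]
  have qr_ne : ∀ a : ℝ, qr q a ≠ 0 := fun a => by
    simpa [qr] using (Real.rpow_pos_of_pos hq0 a).ne'
  have qr_zero : qr q 0 = 1 := by simp [qr]
  have hneg : qr q (-(1 / 2)) * qr q (1 / 2) = 1 := by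
    rw [← qr_add, neg_add_cancel, qr_zero]
  set p := qr q (1 / 2) with hp
  have hpq : (q : ℂ) = p ^ 2 := by
    rw [hp, sq, ← qr_add]
    norm_num [qr]
  have hp1 : ‖p‖ < 1 := by
    rw [hp, qr, norm_real, Real.norm_of_nonneg (Real.rpow_nonneg hq0.le _)]
    exact Real.rpow_lt_one hq0.le hq1 (by norm_num)
  have hpn : ∀ n : ℤ, qr q ((n : ℝ) / 2) = p ^ n := fun n => by
    rw [hp, qr, qr, ← ofReal_zpow, ← Real.rpow_intCast, ← Real.rpow_mul hq0.le]
    congr 2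
    ring
  have hqn : ∀ n : ℤ, qr q n = (p ^ 2) ^ n := fun n => by
    rw [← hpq, qr, Real.rpow_intCast, ofReal_zpow]
  have hterm : ∀ n : ℤ, 1 + z * qr q ((n : ℝ) - 1 / 2) =
      1 - -(qr q (-(1 / 2)) * z) * (p ^ 2) ^ n := fun n => by
    rw [sub_eq_add_neg (n : ℝ), qr_add, hqn]
    ring
  have hxn : ∀ n : ℤ, 1 - -(qr q (-(1 / 2)) * z) * (p ^ 2) ^ n ≠ 0 := fun n h => by
    rw [← hterm] at h
    apply hz' (-n)
    have h1 : qr q ((n : ℝ) - 1 / 2) * qr q (((-n : ℤ) : ℝ) + 1 / 2) = 1 := by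
      rw [← qr_add, ← qr_zero]
      congr 1
      push_cast
      ring
    linear_combination qr q (((-n : ℤ) : ℝ) + 1 / 2) * h - z * h1
  have key := hasSum_kronecker (qr_ne _) hp1
    (neg_ne_zero.mpr (mul_ne_zero (qr_ne _) hz)) hxn
  have hzp : -(qr q (-(1 / 2)) * z) * p = -z := by linear_combination -z * hneg
  rw [hzp] at key
  simpa only [hpn, hterm, hpq] using key
end

section
/- Let s ∈ (0, −2 ln q) and set t := Φ(s) = e^{−s} θ_{q⁴}(q² e^{−2s}) / θ_{q⁴}(e^{−2s}) (which is a real number). Then a nonzero real number x satisfies the secular equation x θ_{q⁴}(q² x²) + t θ_{q⁴}(x²) = 0 if and only if x ∈ {−e^{−s} q^{2m} : m ∈ ℤ} ∪ {e^{s} q^{2n} : n ∈ ℤ}. -/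
open Filter Topology

/-- Real infinite q-Pochhammer symbol `(a;q)_∞`. -/
noncomputable def qpInfR (q a : ℝ) : ℝ := ∏' k : ℕ, (1 - a * q ^ k)

/-- Real theta function `θ_q(x) = (x;q)_∞ (q/x;q)_∞`. -/
noncomputable def thetaR (q x : ℝ) : ℝ := qpInfR q x * qpInfR q (q / x)

/-- The reparametrization function `Φ(s) = e^{-s} θ_{q⁴}(q² e^{-2s}) / θ_{q⁴}(e^{-2s})`. -/
noncomputable def PhiF (q s : ℝ) : ℝ :=
  Real.exp (-s) * thetaR (q ^ 4) (q ^ 2 * Real.exp (-2 * s)) / thetaR (q ^ 4) (Real.exp (-2 * s))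

theorem multipliable_one_sub_mul_pow {p : ℝ} (hp0 : 0 < p) (hp1 : p < 1) (a : ℝ) :
    Multipliable fun k : ℕ => 1 - a * p ^ k := by
  have hs : Summable fun k : ℕ => -(a * p ^ k) :=
    ((summable_geometric_of_lt_one hp0.le hp1).mul_left a).neg
  simpa [sub_eq_add_neg] using Real.multipliable_one_add_of_summable hs

theorem tendsto_qpInfR {p : ℝ} (hp0 : 0 < p) (hp1 : p < 1) (a : ℝ) :
    Tendsto (fun n => ∏ k ∈ Finset.range n, (1 - a * p ^ k)) atTop (𝓝 (qpInfR p a)) :=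
  (multipliable_one_sub_mul_pow hp0 hp1 a).hasProd.tendsto_prod_nat

theorem qpInfR_eq_one_sub_mul {p : ℝ} (hp0 : 0 < p) (hp1 : p < 1) (a : ℝ) :
    qpInfR p a = (1 - a) * qpInfR p (p * a) := by
  have h := (multipliable_one_sub_mul_pow hp0 hp1 (p * a)).congr
    (g := fun k : ℕ => 1 - a * p ^ (k + 1)) (fun k => by ring)
  unfold qpInfR
  rw [tprod_eq_zero_mul' (f := fun k : ℕ => 1 - a * p ^ k) h, pow_zero, mul_one]
  exact congrArg _ (tprod_congr fun k => by ring)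

theorem qpInfR_pos {p : ℝ} (hp0 : 0 < p) (hp1 : p < 1) {a : ℝ} (ha0 : 0 ≤ a) (ha : a < 1) :
    0 < qpInfR p a := by
  have hs : Summable fun k : ℕ => -(a * p ^ k) :=
    ((summable_geometric_of_lt_one hp0.le hp1).mul_left a).neg
  have hpos : ∀ k : ℕ, 0 < 1 + -(a * p ^ k) := fun k => by
    have := mul_le_of_le_one_right ha0 (pow_le_one₀ (n := k) hp0.le hp1.le)
    linarith
  have h := Real.rexp_tsum_eq_tprod hpos (Real.summable_log_one_add_of_summable hs)
  have : qpInfR p a = ∏' k : ℕ, (1 + -(a * p ^ k)) := by simp [qpInfR, sub_eq_add_neg]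
  rw [this, ← h]
  exact Real.exp_pos _

theorem thetaR_eq_one_sub_mul {p : ℝ} (hp0 : 0 < p) (hp1 : p < 1) (x : ℝ) :
    thetaR p x = (1 - x) * (qpInfR p (p * x) * qpInfR p (p / x)) := by
  rw [thetaR, qpInfR_eq_one_sub_mul hp0 hp1 x, mul_assoc]

theorem thetaR_base_div {p : ℝ} (hp0 : p ≠ 0) (x : ℝ) : thetaR p (p / x) = thetaR p x := by
  rw [thetaR, thetaR, div_div_cancel₀ hp0, mul_comm]

theorem thetaR_inv {p : ℝ} (hp0 : 0 < p) (hp1 : p < 1) {x : ℝ} (hx : x ≠ 0) :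
    thetaR p x⁻¹ = -x⁻¹ * thetaR p x := by
  rw [thetaR_eq_one_sub_mul hp0 hp1, thetaR_eq_one_sub_mul hp0 hp1, div_inv_eq_mul,
    ← div_eq_mul_inv]
  field_simp
  ring

theorem thetaR_base_mul {p : ℝ} (hp0 : 0 < p) (hp1 : p < 1) {x : ℝ} (hx : x ≠ 0) :
    thetaR p (p * x) = -x⁻¹ * thetaR p x := by
  rw [← thetaR_inv hp0 hp1 hx, ← thetaR_base_div hp0.ne' x⁻¹, div_inv_eq_mul]

theorem thetaR_pos {p : ℝ} (hp0 : 0 < p) (hp1 : p < 1) {x : ℝ} (hx : p < x) (hx1 : x < 1) :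
    0 < thetaR p x := by
  have hx0 := hp0.trans hx
  exact mul_pos (qpInfR_pos hp0 hp1 hx0.le hx1)
    (qpInfR_pos hp0 hp1 (by positivity) ((div_lt_one hx0).2 hx))

/-- The ratio of the symmetric products `(cu;p)_∞ (c/u;p)_∞` and `(du;p)_∞ (d/u;p)_∞` with
`d ≤ c` is monotone in `u ∈ [c, 1]`, in cross-multiplied form. -/
theorem qpInfR_symm_mul_le {p c d u v : ℝ} (hp0 : 0 < p) (hp1 : p < 1) (hd : 0 < d) (hdc : d ≤ c)
    (hcu : c ≤ u) (huv : u ≤ v) (hv : v ≤ 1) :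
    (qpInfR p (c * u) * qpInfR p (c / u)) * (qpInfR p (d * v) * qpInfR p (d / v)) ≤
      (qpInfR p (c * v) * qpInfR p (c / v)) * (qpInfR p (d * u) * qpInfR p (d / u)) := by
  have hc : 0 < c := hd.trans_le hdc
  have hu : 0 < u := hc.trans_le hcu
  have hv0 : 0 < v := hu.trans_le huv
  have T := tendsto_qpInfR hp0 hp1
  refine le_of_tendsto_of_tendsto'
    (((T (c * u)).mul (T (c / u))).mul ((T (d * v)).mul (T (d / v))))
    (((T (c * v)).mul (T (c / v))).mul ((T (d * u)).mul (T (d / u)))) fun n => ?_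
  simp only [← Finset.prod_mul_distrib]
  have fac : ∀ (a : ℝ) (k : ℕ), a ≤ 1 → 0 ≤ 1 - a * p ^ k := fun a k h1 => by
    have := mul_le_one₀ h1 (by positivity) (pow_le_one₀ (n := k) hp0.le hp1.le)
    linarith
  refine Finset.prod_le_prod (fun k _ => ?_) fun k _ => ?_
  · have h1 : c * u ≤ 1 := by nlinarith
    have h2 : c / u ≤ 1 := (div_le_one hu).2 hcu
    have h3 : d * v ≤ 1 := by nlinarith
    have h4 : d / v ≤ 1 := (div_le_one hv0).2 (by linarith)
    exact mul_nonneg (mul_nonneg (fac _ k h1) (fac _ k h2))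
      (mul_nonneg (fac _ k h3) (fac _ k h4))
  · have hk0 : 0 < p ^ k := by positivity
    have hk1 : p ^ k ≤ 1 := pow_le_one₀ hp0.le hp1.le
    have hw : 0 ≤ (u + 1 / u) - (v + 1 / v) := by
      have : (u + 1 / u) - (v + 1 / v) = (v - u) * (1 - u * v) / (u * v) := by
        field_simp
        ring
      rw [this]
      have : u * v ≤ 1 := by nlinarith
      exact div_nonneg (mul_nonneg (by linarith) (by linarith)) (by positivity)
    have hcd : 0 ≤ (c - d) * p ^ k := mul_nonneg (by linarith) hk0.le
    have h1 : 0 ≤ 1 - (c * p ^ k) * (d * p ^ k) := by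
      have hc1 : c * p ^ k ≤ 1 := mul_le_one₀ (by linarith) hk0.le hk1
      have hd1 : d * p ^ k ≤ 1 := mul_le_one₀ (by linarith) hk0.le hk1
      have := mul_le_one₀ hc1 (by positivity) hd1
      linarith
    rw [← sub_nonneg]
    refine (mul_nonneg (mul_nonneg hw hcd) h1).trans_eq ?_
    field_simp
    ring

/-- The coefficient `x θ_{q⁴}(q² x²)` of the secular equation. -/
noncomputable def secularNum (q x : ℝ) : ℝ := x * thetaR (q ^ 4) (q ^ 2 * x ^ 2)

/-- The coefficient `θ_{q⁴}(x²)` of the secular equation. -/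
noncomputable def secularDen (q x : ℝ) : ℝ := thetaR (q ^ 4) (x ^ 2)

theorem secularNum_neg (q x : ℝ) : secularNum q (-x) = -secularNum q x := by
  simp [secularNum]

theorem secularDen_neg (q x : ℝ) : secularDen q (-x) = secularDen q x := by
  simp [secularDen]

theorem secularNum_inv {q x : ℝ} (hq0 : 0 < q) (hx : x ≠ 0) :
    secularNum q x⁻¹ = (x ^ 2)⁻¹ * secularNum q x := by
  have h : q ^ 2 * x⁻¹ ^ 2 = q ^ 4 / (q ^ 2 * x ^ 2) := by field_simp
  rw [secularNum, secularNum, h, thetaR_base_div (by positivity)]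
  field_simp

theorem secularDen_inv {q x : ℝ} (hq0 : 0 < q) (hq1 : q < 1) (hx : x ≠ 0) :
    secularDen q x⁻¹ = -(x ^ 2)⁻¹ * secularDen q x := by
  rw [secularDen, secularDen, inv_pow, thetaR_inv (by positivity)
    (pow_lt_one₀ hq0.le hq1 four_ne_zero) (by positivity)]

theorem secularNum_sq_mul {q x : ℝ} (hq0 : 0 < q) (hq1 : q < 1) (hx : x ≠ 0) :
    secularNum q (q ^ 2 * x) = -(x ^ 2)⁻¹ * secularNum q x := by
  have h : q ^ 2 * (q ^ 2 * x) ^ 2 = q ^ 4 * (q ^ 2 * x ^ 2) := by ring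
  rw [secularNum, secularNum, h, thetaR_base_mul (by positivity)
    (pow_lt_one₀ hq0.le hq1 four_ne_zero) (by positivity)]
  field_simp

theorem secularDen_sq_mul {q x : ℝ} (hq0 : 0 < q) (hq1 : q < 1) (hx : x ≠ 0) :
    secularDen q (q ^ 2 * x) = -(x ^ 2)⁻¹ * secularDen q x := by
  have h : (q ^ 2 * x) ^ 2 = q ^ 4 * x ^ 2 := by ring
  rw [secularDen, secularDen, h, thetaR_base_mul (by positivity)
    (pow_lt_one₀ hq0.le hq1 four_ne_zero) (by positivity)]

theorem secularNum_sq_div {q x : ℝ} (hq0 : 0 < q) (hq1 : q < 1) (hx : x ≠ 0) :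
    secularNum q (q ^ 2 / x) = -secularNum q x := by
  rw [div_eq_mul_inv, secularNum_sq_mul hq0 hq1 (inv_ne_zero hx), secularNum_inv hq0 hx]
  field_simp

theorem secularDen_sq_div {q x : ℝ} (hq0 : 0 < q) (hq1 : q < 1) (hx : x ≠ 0) :
    secularDen q (q ^ 2 / x) = secularDen q x := by
  rw [div_eq_mul_inv, secularDen_sq_mul hq0 hq1 (inv_ne_zero hx), secularDen_inv hq0 hq1 hx]
  field_simp

theorem secularDen_pos {q x : ℝ} (hq0 : 0 < q) (hq1 : q < 1) (hx : q ^ 2 < x) (hx1 : x < 1) :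
    0 < secularDen q x := by
  have hx0 : 0 < x := lt_trans (by positivity) hx
  refine thetaR_pos (by positivity) (pow_lt_one₀ hq0.le hq1 four_ne_zero) ?_
    (pow_lt_one₀ hx0.le hx1 two_ne_zero)
  calc q ^ 4 = (q ^ 2) ^ 2 := by ring
    _ < x ^ 2 := pow_lt_pow_left₀ hx (by positivity) two_ne_zero

theorem secularDen_one {q : ℝ} (hq0 : 0 < q) (hq1 : q < 1) : secularDen q 1 = 0 := by
  rw [secularDen, thetaR_eq_one_sub_mul (by positivity) (pow_lt_one₀ hq0.le hq1 four_ne_zero)]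
  simp

theorem secularNum_one_pos {q : ℝ} (hq0 : 0 < q) (hq1 : q < 1) : 0 < secularNum q 1 := by
  have h2 : q ^ 2 < 1 := pow_lt_one₀ hq0.le hq1 two_ne_zero
  rw [secularNum, one_mul, one_pow, mul_one]
  exact thetaR_pos (by positivity) (pow_lt_one₀ hq0.le hq1 four_ne_zero)
    (pow_lt_pow_right_of_lt_one₀ hq0 hq1 (by norm_num)) h2

theorem secularNum_mul_secularDen_lt {q x y : ℝ} (hq0 : 0 < q) (hx : q ≤ x) (hxy : x < y)
    (hy : y < 1) : secularNum q x * secularDen q y < secularNum q y * secularDen q x := by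
  have hx0 := hq0.trans_le hx
  have hy0 := hx0.trans hxy
  have hq1 := (hx.trans_lt hxy).trans hy
  have hp0 : 0 < q ^ 4 := by positivity
  have hp1 : q ^ 4 < 1 := pow_lt_one₀ hq0.le hq1 four_ne_zero
  have hcx : q ^ 2 ≤ x ^ 2 := pow_le_pow_left₀ hq0.le hx 2
  have hxy2 : x ^ 2 < y ^ 2 := pow_lt_pow_left₀ hxy hx0.le two_ne_zero
  have hy2 : y ^ 2 < 1 := pow_lt_one₀ hy0.le hy two_ne_zero
  have hdc : q ^ 4 < q ^ 2 := pow_lt_pow_right_of_lt_one₀ hq0 hq1 (by norm_num)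
  have hle := qpInfR_symm_mul_le hp0 hp1 hp0 hdc.le hcx hxy2.le hy2.le
  have hq2 : q ^ 2 < 1 := pow_lt_one₀ hq0.le hq1 two_ne_zero
  have hlt : x * (1 - y ^ 2) < y * (1 - x ^ 2) := by nlinarith [mul_pos hx0 hy0]
  have hpos : 0 < (qpInfR (q ^ 4) (q ^ 2 * y ^ 2) * qpInfR (q ^ 4) (q ^ 2 / y ^ 2)) *
      (qpInfR (q ^ 4) (q ^ 4 * x ^ 2) * qpInfR (q ^ 4) (q ^ 4 / x ^ 2)) := by
    have hx2 : 0 < x ^ 2 := by positivity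
    have hy2' : 0 < y ^ 2 := by positivity
    have h1 := qpInfR_pos hp0 hp1 (a := q ^ 2 * y ^ 2) (by positivity) (by nlinarith)
    have h2 := qpInfR_pos hp0 hp1 (a := q ^ 2 / y ^ 2) (by positivity)
      ((div_lt_one hy2').2 (by linarith))
    have h3 := qpInfR_pos hp0 hp1 (a := q ^ 4 * x ^ 2) (by positivity) (by nlinarith)
    have h4 := qpInfR_pos hp0 hp1 (a := q ^ 4 / x ^ 2) (by positivity)
      ((div_lt_one hx2).2 (by linarith))
    positivity
  have hnum : ∀ z : ℝ, 0 < z → secularNum q z =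
      z * (qpInfR (q ^ 4) (q ^ 2 * z ^ 2) * qpInfR (q ^ 4) (q ^ 2 / z ^ 2)) := fun z hz => by
    have : q ^ 4 / (q ^ 2 * z ^ 2) = q ^ 2 / z ^ 2 := by field_simp
    rw [secularNum, thetaR, this]
  rw [hnum x hx0, hnum y hy0, secularDen, secularDen, thetaR_eq_one_sub_mul hp0 hp1,
    thetaR_eq_one_sub_mul hp0 hp1]
  have h1 := mul_le_mul_of_nonneg_left hle
    (mul_nonneg hx0.le (sub_nonneg.2 hy2.le))
  have h2 := mul_lt_mul_of_pos_right hlt hpos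
  linarith

theorem strictMonoOn_secularNum_div_secularDen {q : ℝ} (hq0 : 0 < q) (hq1 : q < 1) :
    StrictMonoOn (fun x => secularNum q x / secularDen q x) (Set.Ioo (q ^ 2) 1) := by
  have hqq : q ^ 2 < q := by nlinarith
  have right : ∀ {x y : ℝ}, q ≤ x → x < y → y < 1 →
      secularNum q x / secularDen q x < secularNum q y / secularDen q y := fun hx hxy hy =>
    (div_lt_div_iff₀ (secularDen_pos hq0 hq1 (hqq.trans_le hx) (hxy.trans hy))
      (secularDen_pos hq0 hq1 (hqq.trans_le (hx.trans hxy.le)) hy)).2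
      (secularNum_mul_secularDen_lt hq0 hx hxy hy)
  have left : ∀ {x y : ℝ}, q ^ 2 < x → x < y → y ≤ q →
      secularNum q x / secularDen q x < secularNum q y / secularDen q y := fun {x y} hx hxy hy => by
    have hx0 : 0 < x := lt_trans (by positivity) hx
    have hy0 := hx0.trans hxy
    have h := right (x := q ^ 2 / y) (y := q ^ 2 / x) ((le_div_iff₀ hy0).2 (by nlinarith))
      (div_lt_div_of_pos_left (by positivity) hx0 hxy) ((div_lt_one hx0).2 hx)
    rw [secularNum_sq_div hq0 hq1 hx0.ne', secularNum_sq_div hq0 hq1 hy0.ne',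
      secularDen_sq_div hq0 hq1 hx0.ne', secularDen_sq_div hq0 hq1 hy0.ne', neg_div, neg_div] at h
    linarith
  intro x hx y hy hxy
  rcases le_or_gt q x with h | h
  · exact right h hxy hy.2
  rcases le_or_gt y q with h' | h'
  · exact left hx.1 hxy h'
  · exact (left hx.1 h le_rfl).trans (right le_rfl h' hy.2)

theorem secular_eq_zero_mul_zpow_iff {q : ℝ} (hq0 : 0 < q) (hq1 : q < 1) (t : ℝ) {x : ℝ}
    (hx : x ≠ 0) (m : ℤ) :
    secularNum q (x * q ^ (2 * m)) + t * secularDen q (x * q ^ (2 * m)) = 0 ↔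
      secularNum q x + t * secularDen q x = 0 := by
  have step : ∀ m : ℤ,
      secularNum q (x * q ^ (2 * (m + 1))) + t * secularDen q (x * q ^ (2 * (m + 1))) = 0 ↔
        secularNum q (x * q ^ (2 * m)) + t * secularDen q (x * q ^ (2 * m)) = 0 := fun m => by
    have hz : x * q ^ (2 * m) ≠ 0 := mul_ne_zero hx (zpow_ne_zero _ hq0.ne')
    have h : x * q ^ (2 * (m + 1)) = q ^ 2 * (x * q ^ (2 * m)) := by
      rw [mul_add, zpow_add₀ hq0.ne']
      norm_cast
      ring
    rw [h, secularNum_sq_mul hq0 hq1 hz, secularDen_sq_mul hq0 hq1 hz, mul_left_comm, ← mul_add,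
      mul_eq_zero_iff_left (neg_ne_zero.2 (inv_ne_zero (pow_ne_zero 2 hz)))]
  induction m with
  | zero => simp
  | succ n ih => exact (step n).trans ih
  | pred n ih =>
    have h := step (-n - 1)
    rw [sub_add_cancel] at h
    exact h.symm.trans ih

theorem exists_eq_mul_zpow {q r : ℝ} (hq0 : 0 < q) (hq1 : q < 1) (hr : 0 < r) :
    ∃ u ∈ Set.Ioc (q ^ 2) 1, ∃ m : ℤ, r = u * q ^ (2 * m) := by
  have hq2 : q ^ 2 < 1 := pow_lt_one₀ hq0.le hq1 two_ne_zero
  have hq20 : 0 < q ^ 2 := by positivity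
  obtain ⟨n, hn1, hn2⟩ := exists_mem_Ioc_zpow hr ((one_lt_inv₀ hq20).2 hq2)
  rw [inv_zpow'] at hn1 hn2
  have hpos : ∀ k : ℤ, 0 < (q ^ 2) ^ k := fun k => zpow_pos hq20 k
  refine ⟨r * (q ^ 2) ^ (n + 1), ⟨?_, ?_⟩, -(n + 1), ?_⟩
  · have := mul_lt_mul_of_pos_right hn1 (hpos (n + 1))
    rwa [← zpow_add₀ hq20.ne', neg_add_cancel_left, zpow_one] at this
  · have := mul_le_mul_of_nonneg_right hn2 (hpos (n + 1)).le
    rwa [← zpow_add₀ hq20.ne', neg_add_cancel, zpow_zero] at this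
  · have : q ^ (2 * -(n + 1)) = (q ^ 2) ^ (-(n + 1)) := by
      rw [zpow_mul]
      norm_cast
    rw [this, mul_assoc, ← zpow_add₀ hq20.ne', add_neg_cancel, zpow_zero, mul_one]

theorem stmt_6 (q : ℝ) (hq0 : 0 < q) (hq1 : q < 1) (s : ℝ)
    (hs : s ∈ Set.Ioo 0 (-(2 * Real.log q))) (x : ℝ) (hx : x ≠ 0) :
    x * thetaR (q ^ 4) (q ^ 2 * x ^ 2) + PhiF q s * thetaR (q ^ 4) (x ^ 2) = 0 ↔
      ((∃ m : ℤ, x = -Real.exp (-s) * q ^ (2 * m)) ∨ (∃ n : ℤ, x = Real.exp s * q ^ (2 * n))) := by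
  set y := Real.exp (-s) with hy
  have hy0 : 0 < y := Real.exp_pos _
  have hy1 : y < 1 := Real.exp_lt_one_iff.2 (by linarith [hs.1])
  have hqy : q ^ 2 < y := by
    rw [hy, ← Real.log_lt_iff_lt_exp (by positivity), Real.log_pow]
    push_cast
    linarith [hs.2]
  have hexp : Real.exp s = y⁻¹ := by rw [hy, Real.exp_neg, inv_inv]
  have hsq : Real.exp (-2 * s) = y ^ 2 := by
    rw [hy, ← Real.exp_nat_mul]
    push_cast
    ring_nf
  have hDy := secularDen_pos hq0 hq1 hqy hy1
  have ht : PhiF q s = secularNum q y / secularDen q y := by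
    rw [PhiF, hsq, secularNum, secularDen, hy]
  have inj := (strictMonoOn_secularNum_div_secularDen hq0 hq1).injOn
  set t := PhiF q s
  change secularNum q x + t * secularDen q x = 0 ↔ _
  rw [hexp]
  constructor
  · intro hF
    obtain ⟨u, hu, m, hm⟩ := exists_eq_mul_zpow hq0 hq1 (abs_pos.2 hx)
    have hu0 : 0 < u := lt_trans (by positivity) hu.1
    rcases hx.lt_or_gt with hneg | hpos
    · left
      have hxu : x = -u * q ^ (2 * m) := by
        rw [abs_of_neg hneg] at hm
        linarith
      rw [hxu, secular_eq_zero_mul_zpow_iff hq0 hq1 t (neg_ne_zero.2 hu0.ne'), secularNum_neg,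
        secularDen_neg] at hF
      rcases hu.2.eq_or_lt with rfl | hu1
      · rw [secularDen_one hq0 hq1] at hF
        linarith [secularNum_one_pos hq0 hq1]
      · have hDu := secularDen_pos hq0 hq1 hu.1 hu1
        have : u = y := inj ⟨hu.1, hu1⟩ ⟨hqy, hy1⟩ <| by
          change secularNum q u / secularDen q u = secularNum q y / secularDen q y
          rw [← ht, div_eq_iff hDu.ne']
          linarith
        exact ⟨m, by rw [hxu, this]⟩
    · right
      rw [abs_of_pos hpos] at hm
      rw [hm, secular_eq_zero_mul_zpow_iff hq0 hq1 t hu0.ne'] at hF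
      rcases hu.2.eq_or_lt with rfl | hu1
      · rw [secularDen_one hq0 hq1] at hF
        linarith [secularNum_one_pos hq0 hq1]
      · have hDu := secularDen_pos hq0 hq1 hu.1 hu1
        have hmem : q ^ 2 / u ∈ Set.Ioo (q ^ 2) 1 :=
          ⟨(lt_div_iff₀ hu0).2 (mul_lt_of_lt_one_right (by positivity) hu1),
            (div_lt_one hu0).2 hu.1⟩
        have : q ^ 2 / u = y := inj hmem ⟨hqy, hy1⟩ <| by
          change secularNum q (q ^ 2 / u) / secularDen q (q ^ 2 / u) =
            secularNum q y / secularDen q y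
          rw [secularNum_sq_div hq0 hq1 hu0.ne', secularDen_sq_div hq0 hq1 hu0.ne', ← ht,
            div_eq_iff hDu.ne']
          linarith
        refine ⟨m + 1, ?_⟩
        rw [hm, ← this, mul_add, zpow_add₀ hq0.ne']
        norm_cast
        field_simp
  · rintro (⟨m, rfl⟩ | ⟨n, rfl⟩)
    · rw [secular_eq_zero_mul_zpow_iff hq0 hq1 t (neg_ne_zero.2 hy0.ne'), secularNum_neg,
        secularDen_neg, ht, div_mul_cancel₀ _ hDy.ne', neg_add_cancel]
    · rw [secular_eq_zero_mul_zpow_iff hq0 hq1 t (inv_ne_zero hy0.ne'),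
        secularNum_inv hq0 hy0.ne', secularDen_inv hq0 hq1 hy0.ne', ht]
      field_simp
      ring
end
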